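/- arXiv:2404.14365 — 7 statements merged into one kernel-verified Lean document; each statement's English description precedes it below -/
import Mathlib

section
/- Let k ≥ 1 and let Q_0, …, Q_k ∈ ℂ[x] with Q_k ≠ 0, and let T be the associated differential operator T(p) = ∑_{j=0}^k Q_j · p^{(j)}. Then for every integer n ≥ 0, every closed T_{≥n}-invariant subset S ⊆ ℂ is convex. -/
open Polynomial

/-- The differential operator `T(p) = ∑_{j=0}^k Q_j · p^{(j)}`. -/
noncomputable def diffOp (k : ℕ) (Q : ℕ → Polynomial ℂ) (p : Polynomial ℂ) : Polynomial ℂ :=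
  ∑ j ∈ Finset.range (k + 1), Q j * (⇑(Polynomial.derivative (R := ℂ)))^[j] p

/-- A set `S ⊆ ℂ` is `T_{≥n}`-invariant: for every nonzero polynomial `p` with `deg p ≥ n`
all of whose zeros lie in `S`, either `T p = 0` or all zeros of `T p` lie in `S`. -/
def TGeInvariant (T : Polynomial ℂ → Polynomial ℂ) (n : ℕ) (S : Set ℂ) : Prop :=
  ∀ p : Polynomial ℂ, p ≠ 0 → n ≤ p.natDegree → (∀ z : ℂ, p.eval z = 0 → z ∈ S) →
    T p = 0 ∨ ∀ z : ℂ, (T p).eval z = 0 → z ∈ S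

open Filter Topology

/-- A polynomial without zeros in the open disc of radius `ε` around `c` is bounded on the closed
disc by its value at the centre, up to a constant depending only on a bound for the degree. -/
lemma norm_eval_le_of_roots_far {f : ℂ[X]} {c z : ℂ} {ε : ℝ} {d : ℕ} (hd : f.natDegree ≤ d)
    (hz : ‖z - c‖ ≤ ε) (hf : ∀ r ∈ f.roots, ε ≤ ‖c - r‖) :
    ‖f.eval z‖ ≤ 2 ^ d * ‖f.eval c‖ := by
  have key : ∀ s : Multiset ℂ, (∀ r ∈ s, ε ≤ ‖c - r‖) →
      ‖(s.map (z - ·)).prod‖ ≤ 2 ^ s.card * ‖(s.map (c - ·)).prod‖ := by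
    intro s
    induction s using Multiset.induction with
    | empty => simp
    | cons r s ih =>
      intro hs
      have hr : ‖z - r‖ ≤ 2 * ‖c - r‖ := by
        have h₁ := norm_add_le (z - c) (c - r)
        rw [sub_add_sub_cancel] at h₁
        have h₂ := hs r (Multiset.mem_cons_self r s)
        linarith
      have hs' := ih fun r' hr' => hs r' (Multiset.mem_cons_of_mem hr')
      simp only [Multiset.map_cons, Multiset.prod_cons, norm_mul, Multiset.card_cons]
      calc _ ≤ (2 * ‖c - r‖) * (2 ^ s.card * ‖(s.map (c - ·)).prod‖) := by gcongr
        _ = _ := by ring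
  have hsplit := IsAlgClosed.splits f
  rw [hsplit.eval_eq_prod_roots z, hsplit.eval_eq_prod_roots c, norm_mul, norm_mul]
  calc _ ≤ ‖f.leadingCoeff‖ * (2 ^ f.roots.card * ‖(f.roots.map (c - ·)).prod‖) := by
        gcongr
        exact key _ hf
    _ ≤ ‖f.leadingCoeff‖ * (2 ^ d * ‖(f.roots.map (c - ·)).prod‖) := by
        gcongr
        · norm_num
        · exact (card_roots' f).trans hd
    _ = _ := by ring

/-- The cofactor of `(X - a) ^ (M - k) * (X - b) ^ (N - k)` in the `j`-th derivative of
`(X - a) ^ M * (X - b) ^ N`, for `j ≤ k ≤ M, N`. -/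
noncomputable def derivCofactor (a b : ℂ) (k M N j : ℕ) : ℂ[X] :=
  ∑ i ∈ Finset.range (j + 1),
    C ((j.choose i : ℂ) * (M.descFactorial (j - i) : ℂ) * (N.descFactorial i : ℂ)) *
      ((X - C a) ^ (k - (j - i)) * (X - C b) ^ (k - i))

lemma iterate_derivative_eq_mul_derivCofactor (a b : ℂ) {k M N j : ℕ} (hj : j ≤ k) (hM : k ≤ M)
    (hN : k ≤ N) :
    derivative^[j] ((X - C a) ^ M * (X - C b) ^ N) =
      (X - C a) ^ (M - k) * (X - C b) ^ (N - k) * derivCofactor a b k M N j := by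
  rw [iterate_derivative_mul, derivCofactor, Finset.mul_sum]
  refine Finset.sum_congr rfl fun i hi => ?_
  have hi' : i ≤ j := Nat.lt_succ_iff.mp (Finset.mem_range.mp hi)
  rw [iterate_derivative_X_sub_pow, iterate_derivative_X_sub_pow,
    show M - (j - i) = (M - k) + (k - (j - i)) by omega,
    show N - i = (N - k) + (k - i) by omega]
  simp only [nsmul_eq_mul, pow_add, map_mul, map_natCast]
  ring

lemma natDegree_derivCofactor_le (a b : ℂ) (k M N j : ℕ) :
    (derivCofactor a b k M N j).natDegree ≤ k + k := by
  refine natDegree_sum_le_of_forall_le _ _ fun i _ => (natDegree_C_mul_le _ _).trans ?_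
  refine natDegree_mul_le.trans (add_le_add ?_ ?_) <;>
  · rw [natDegree_pow, natDegree_X_sub_C]
    omega

lemma tendsto_descFactorial_div_pow {M : ℕ → ℕ} {α : ℝ}
    (hM : Tendsto (fun m => (M m : ℂ) / (m : ℂ)) atTop (𝓝 (α : ℂ))) (hM' : Tendsto M atTop atTop)
    (i : ℕ) :
    Tendsto (fun m => ((M m).descFactorial i : ℂ) / (m : ℂ) ^ i) atTop (𝓝 ((α : ℂ) ^ i)) := by
  induction i with
  | zero => simp
  | succ i ih =>
    have h₁ : Tendsto (fun m : ℕ => (i : ℂ) / (m : ℂ)) atTop (𝓝 0) :=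
      tendsto_const_div_atTop_nhds_zero_nat (i : ℂ)
    have h₂ := (hM.sub h₁).mul ih
    rw [sub_zero, ← pow_succ'] at h₂
    refine h₂.congr' ?_
    filter_upwards [hM'.eventually_ge_atTop i] with m hm
    rw [Nat.descFactorial_succ, Nat.cast_mul, Nat.cast_sub hm, pow_succ', ← sub_div,
      div_mul_div_comm]

lemma tendsto_eval_derivCofactor_div_pow (a b z : ℂ) (k j : ℕ) {M N : ℕ → ℕ} {α β : ℝ}
    (hM : Tendsto (fun m => (M m : ℂ) / (m : ℂ)) atTop (𝓝 (α : ℂ))) (hM' : Tendsto M atTop atTop)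
    (hN : Tendsto (fun m => (N m : ℂ) / (m : ℂ)) atTop (𝓝 (β : ℂ)))
    (hN' : Tendsto N atTop atTop) :
    Tendsto (fun m : ℕ => (derivCofactor a b k (M m) (N m) j).eval z / (m : ℂ) ^ j) atTop
      (𝓝 (∑ i ∈ Finset.range (j + 1), (j.choose i : ℂ) * ((α : ℂ) ^ (j - i) * (β : ℂ) ^ i) *
        ((z - a) ^ (k - (j - i)) * (z - b) ^ (k - i)))) := by
  simp only [derivCofactor, eval_finsetSum, Finset.sum_div]
  refine tendsto_finsetSum _ fun i hi => ?_
  have hi' : i ≤ j := Nat.lt_succ_iff.mp (Finset.mem_range.mp hi)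
  have h := (((tendsto_descFactorial_div_pow hM hM' (j - i)).mul
    (tendsto_descFactorial_div_pow hN hN' i)).const_mul (j.choose i : ℂ)).mul_const
      ((z - a) ^ (k - (j - i)) * (z - b) ^ (k - i))
  refine h.congr fun m => ?_
  rw [div_mul_div_comm, ← pow_add, Nat.sub_add_cancel hi']
  simp only [eval_mul, eval_C, eval_pow, eval_sub, eval_X]
  ring

/-- The cofactor of `(X - a) ^ (M - k) * (X - b) ^ (N - k)` in the image of
`(X - a) ^ M * (X - b) ^ N` under `diffOp k Q`. -/
noncomputable def diffOpCofactor (k : ℕ) (Q : ℕ → ℂ[X]) (a b : ℂ) (M N : ℕ) : ℂ[X] :=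
  ∑ j ∈ Finset.range (k + 1), Q j * derivCofactor a b k M N j

lemma diffOp_eq_mul_diffOpCofactor (Q : ℕ → ℂ[X]) (a b : ℂ) {k M N : ℕ} (hM : k ≤ M)
    (hN : k ≤ N) :
    diffOp k Q ((X - C a) ^ M * (X - C b) ^ N) =
      (X - C a) ^ (M - k) * (X - C b) ^ (N - k) * diffOpCofactor k Q a b M N := by
  rw [diffOp, diffOpCofactor, Finset.mul_sum]
  refine Finset.sum_congr rfl fun j hj => ?_
  rw [iterate_derivative_eq_mul_derivCofactor a b
    (Nat.lt_succ_iff.mp (Finset.mem_range.mp hj)) hM hN]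
  ring

lemma natDegree_diffOpCofactor_le (k : ℕ) (Q : ℕ → ℂ[X]) (a b : ℂ) (M N : ℕ) :
    (diffOpCofactor k Q a b M N).natDegree ≤
      (Finset.range (k + 1)).sup (fun j => (Q j).natDegree) + (k + k) := by
  refine natDegree_sum_le_of_forall_le _ _ fun j hj => ?_
  exact natDegree_mul_le.trans (add_le_add
    (Finset.le_sup (f := fun j => (Q j).natDegree) hj) (natDegree_derivCofactor_le ..))

lemma tendsto_eval_diffOpCofactor_div_pow (k : ℕ) (Q : ℕ → ℂ[X]) (a b z : ℂ) {M N : ℕ → ℕ}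
    {α β : ℝ}
    (hM : Tendsto (fun m => (M m : ℂ) / (m : ℂ)) atTop (𝓝 (α : ℂ))) (hM' : Tendsto M atTop atTop)
    (hN : Tendsto (fun m => (N m : ℂ) / (m : ℂ)) atTop (𝓝 (β : ℂ)))
    (hN' : Tendsto N atTop atTop) :
    Tendsto (fun m : ℕ => (diffOpCofactor k Q a b (M m) (N m)).eval z / (m : ℂ) ^ k) atTop
      (𝓝 ((Q k).eval z * (β * (z - a) + α * (z - b)) ^ k)) := by
  simp only [diffOpCofactor, eval_finsetSum, Finset.sum_div, eval_mul, mul_div_assoc]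
  rw [show (Q k).eval z * (β * (z - a) + α * (z - b)) ^ k =
    ∑ j ∈ Finset.range (k + 1),
      (Q j).eval z * (if j = k then (β * (z - a) + α * (z - b)) ^ k else 0) by simp]
  refine tendsto_finsetSum _ fun j hj => Tendsto.const_mul _ ?_
  have h := tendsto_eval_derivCofactor_div_pow a b z k j hM hM' hN hN'
  split_ifs with hjk
  · subst hjk
    convert h using 2
    rw [add_pow]
    refine Finset.sum_congr rfl fun i hi => ?_
    rw [Nat.sub_sub_self (Nat.lt_succ_iff.mp (Finset.mem_range.mp hi)), mul_pow, mul_pow]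
    ring
  · have hlt : j < k := lt_of_le_of_ne (Nat.lt_succ_iff.mp (Finset.mem_range.mp hj)) hjk
    have h₀ : Tendsto (fun m : ℕ => (1 / (m : ℂ)) ^ (k - j)) atTop (𝓝 0) := by
      have := (tendsto_const_div_atTop_nhds_zero_nat (1 : ℂ)).pow (k - j)
      rwa [zero_pow (by omega)] at this
    have h₁ := h.mul h₀
    rw [mul_zero] at h₁
    refine h₁.congr fun m => ?_
    rw [one_div_pow, div_mul_div_comm, mul_one, ← pow_add, Nat.add_sub_cancel' hlt.le]

lemma tendsto_floor_mul_natCast_div {α : ℝ} (hα : 0 < α) :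
    Tendsto (fun m : ℕ => (⌊α * m⌋₊ : ℂ) / (m : ℂ)) atTop (𝓝 (α : ℂ)) := by
  have h := (tendsto_nat_floor_mul_div_atTop hα.le).comp (tendsto_natCast_atTop_atTop (R := ℝ))
  refine ((Complex.continuous_ofReal.tendsto α).comp h).congr fun m => ?_
  simp

lemma tendsto_floor_mul_natCast_atTop {α : ℝ} (hα : 0 < α) :
    Tendsto (fun m : ℕ => ⌊α * m⌋₊) atTop atTop :=
  tendsto_nat_floor_atTop.comp (tendsto_natCast_atTop_atTop.const_mul_atTop hα)

theorem closed_TGe_invariant_convex (k : ℕ) (hk : 1 ≤ k) (Q : ℕ → Polynomial ℂ)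
    (hQk : Q k ≠ 0) (n : ℕ) (S : Set ℂ) (hSclosed : IsClosed S)
    (hSinv : TGeInvariant (diffOp k Q) n S) :
    Convex ℝ S := by
  rw [convex_iff_forall_pos]
  intro a ha b hb β α hβ hα hsum
  by_contra hc
  set c : ℂ := β • a + α • b with hcdef
  have hlin : ∀ z : ℂ, (β : ℂ) * (z - a) + α * (z - b) = z - c := fun z => by
    have hsum' : (β : ℂ) + α = 1 := by exact_mod_cast hsum
    rw [hcdef, Complex.real_smul, Complex.real_smul]
    linear_combination z * hsum'
  obtain ⟨ε, hε, hball⟩ := Metric.isOpen_iff.mp hSclosed.isOpen_compl c hc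
  set d := (Finset.range (k + 1)).sup (fun j => (Q j).natDegree) + (k + k)
  let M : ℕ → ℕ := fun m => ⌊α * m⌋₊
  let N : ℕ → ℕ := fun m => ⌊β * m⌋₊
  have hM' : Tendsto M atTop atTop := tendsto_floor_mul_natCast_atTop hα
  have hN' : Tendsto N atTop atTop := tendsto_floor_mul_natCast_atTop hβ
  have hlim := fun z => tendsto_eval_diffOpCofactor_div_pow k Q a b z
    (tendsto_floor_mul_natCast_div hα) hM' (tendsto_floor_mul_natCast_div hβ) hN'
  simp only [hlin] at hlim
  have hroots : ∀ᶠ m in atTop, ∀ r ∈ (diffOpCofactor k Q a b (M m) (N m)).roots,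
      ε ≤ ‖c - r‖ := by
    filter_upwards [hM'.eventually_ge_atTop (max k n), hN'.eventually_ge_atTop k] with m hm hm'
    intro r hr
    have hne : (X - C a) ^ M m * (X - C b) ^ N m ≠ 0 :=
      mul_ne_zero (pow_ne_zero _ (X_sub_C_ne_zero a)) (pow_ne_zero _ (X_sub_C_ne_zero b))
    have hdeg : n ≤ ((X - C a) ^ M m * (X - C b) ^ N m).natDegree := by
      rw [natDegree_mul (left_ne_zero_of_mul hne) (right_ne_zero_of_mul hne), natDegree_pow,
        natDegree_X_sub_C]
      omega
    have hzeros : ∀ z : ℂ, ((X - C a) ^ M m * (X - C b) ^ N m).eval z = 0 → z ∈ S := by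
      intro z hz
      simp only [eval_mul, eval_pow, eval_sub, eval_X, eval_C, mul_eq_zero] at hz
      rcases hz with hz | hz
      · rwa [sub_eq_zero.mp (eq_zero_of_pow_eq_zero hz)]
      · rwa [sub_eq_zero.mp (eq_zero_of_pow_eq_zero hz)]
    have hrS : r ∈ S := by
      have h := hSinv _ hne hdeg hzeros
      rw [diffOp_eq_mul_diffOpCofactor Q a b (by omega) hm'] at h
      rcases h with h | h
      · refine absurd h (mul_ne_zero (mul_ne_zero (pow_ne_zero _ (X_sub_C_ne_zero a))
          (pow_ne_zero _ (X_sub_C_ne_zero b))) (ne_zero_of_mem_roots hr))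
      · exact h r (by rw [eval_mul, (isRoot_of_mem_roots hr).eq_zero, mul_zero])
    by_contra! hlt
    exact hball (by rwa [Metric.mem_ball, dist_comm, dist_eq_norm]) hrS
  have hvanish : ∀ z ∈ Metric.ball c ε, (Q k * (X - C c) ^ k).eval z = 0 := by
    intro z hz
    have hle := le_of_tendsto_of_tendsto (hlim z).norm ((hlim c).norm.const_mul (2 ^ d))
      (hroots.mono fun m hm => by
        simp only [norm_div, ← mul_div_assoc]
        gcongr
        exact norm_eval_le_of_roots_far (natDegree_diffOpCofactor_le ..)
          (by rw [← dist_eq_norm]; exact (Metric.mem_ball.mp hz).le) hm)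
    rw [sub_self, zero_pow (by omega), mul_zero, norm_zero, mul_zero] at hle
    simpa using norm_le_zero_iff.mp hle
  refine mul_ne_zero hQk (pow_ne_zero k (X_sub_C_ne_zero c)) (eq_zero_of_infinite_isRoot _ ?_)
  exact (infinite_of_mem_nhds c (Metric.ball_mem_nhds c hε)).mono hvanish
end

section
/- Let k ≥ 1 and let Q_0, …, Q_k ∈ ℂ[x] with Q_k ≠ 0, and let T(p) = ∑_{j=0}^k Q_j · p^{(j)}. If for some integer n ≥ 0 a set S ⊆ ℂ is closed, unbounded and T_{≥n}-invariant, then S is T_{≥m}-invariant for every integer m ≥ 0; in particular S is T-invariant. -/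
open Polynomial

/-- If all points of a multiset are at distance at least `r ≥ ‖z - w‖` from `w`, the product of
the distances to `z` is at most `2 ^ card` times the product of the distances to `w`. -/
theorem norm_multiset_prod_sub_le {z w : ℂ} {r : ℝ} (hz : ‖z - w‖ ≤ r) (s : Multiset ℂ)
    (hs : ∀ a ∈ s, r ≤ ‖w - a‖) :
    ‖(s.map (z - ·)).prod‖ ≤ 2 ^ s.card * ‖(s.map (w - ·)).prod‖ := by
  induction s using Multiset.induction_on with
  | empty => simp
  | cons a s ih =>
    have ih' := ih fun b hb => hs b (Multiset.mem_cons_of_mem hb)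
    have ha := hs a (Multiset.mem_cons_self a s)
    have hza : ‖z - a‖ ≤ 2 * ‖w - a‖ := by
      have := norm_add_le (z - w) (w - a)
      rw [sub_add_sub_cancel] at this
      linarith
    simp only [Multiset.map_cons, Multiset.prod_cons, norm_mul, Multiset.card_cons]
    calc ‖z - a‖ * ‖(s.map (z - ·)).prod‖
        ≤ (2 * ‖w - a‖) * (2 ^ s.card * ‖(s.map (w - ·)).prod‖) := by gcongr
      _ = _ := by ring

/-- A Harnack-type bound for a complex polynomial without zeros in the open ball `B(w, r)`. -/
theorem Polynomial.norm_eval_le_of_no_zero_in_ball {q : ℂ[X]} {z w : ℂ} {r : ℝ} {D : ℕ}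
    (hz : ‖z - w‖ ≤ r) (hD : q.natDegree ≤ D) (hq : ∀ a, q.eval a = 0 → r ≤ ‖w - a‖) :
    ‖q.eval z‖ ≤ 2 ^ D * ‖q.eval w‖ := by
  have hsplit := IsAlgClosed.splits q
  have hroots : ∀ a ∈ q.roots, r ≤ ‖w - a‖ := fun a ha => hq a (isRoot_of_mem_roots ha)
  have hcard : q.roots.card ≤ D := (card_roots' q).trans hD
  rw [hsplit.eval_eq_prod_roots z, hsplit.eval_eq_prod_roots w, norm_mul, norm_mul]
  calc ‖q.leadingCoeff‖ * ‖(q.roots.map (z - ·)).prod‖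
      ≤ ‖q.leadingCoeff‖ * (2 ^ q.roots.card * ‖(q.roots.map (w - ·)).prod‖) := by
        gcongr
        exact norm_multiset_prod_sub_le hz _ hroots
    _ ≤ ‖q.leadingCoeff‖ * (2 ^ D * ‖(q.roots.map (w - ·)).prod‖) := by
        gcongr
        norm_num
    _ = _ := by ring

/-- Hurwitz-type persistence of zeros: a zero of the nonzero member `R 0` of the polynomial family
`∑ m, ε ^ m R m` is approximated by zeros of the nearby members, which are nonzero. -/
theorem Polynomial.exists_zero_near_of_family (n : ℕ) (R : ℕ → ℂ[X]) (hR : R 0 ≠ 0) {w : ℂ}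
    (hw : (R 0).eval w = 0) {r : ℝ} (hr : 0 < r) :
    ∀ᶠ ε in nhds (0 : ℂ), ∑ m ∈ Finset.range (n + 1), C (ε ^ m) * R m ≠ 0 ∧
      ∃ a ∈ Metric.ball w r, (∑ m ∈ Finset.range (n + 1), C (ε ^ m) * R m).eval a = 0 := by
  obtain ⟨z, hz, hz0⟩ : ∃ z ∈ Metric.ball w r, (R 0).eval z ≠ 0 := by
    by_contra! h
    exact hR (eq_zero_of_infinite_isRoot _
      ((infinite_of_mem_nhds w (Metric.ball_mem_nhds w hr)).mono h))
  set D := (Finset.range (n + 1)).sup fun m => (R m).natDegree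
  set q : ℂ → ℂ[X] := fun ε => ∑ m ∈ Finset.range (n + 1), C (ε ^ m) * R m with hq
  have hD : ∀ ε, (q ε).natDegree ≤ D := fun ε =>
    natDegree_sum_le_of_forall_le _ _ fun m hm => (natDegree_C_mul_le _ _).trans
      (Finset.le_sup (f := fun m => (R m).natDegree) hm)
  have hcont : ∀ a, Continuous fun ε => (q ε).eval a := fun a => by
    simp only [hq, eval_finsetSum, eval_mul, eval_C]
    fun_prop
  have hq0 : q 0 = R 0 := by
    simp [hq, Finset.sum_range_succ']
  have hev : ∀ᶠ ε in nhds (0 : ℂ), 2 ^ D * ‖(q ε).eval w‖ < ‖(q ε).eval z‖ := by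
    refine ((hcont w).norm.const_mul _).continuousAt.eventually_lt (hcont z).norm.continuousAt ?_
    simpa [hq0, hw] using hz0
  filter_upwards [hev] with ε hε
  refine ⟨fun h0 => ?_, ?_⟩
  · change q ε = 0 at h0
    simp [h0] at hε
  · by_contra! h
    refine hε.not_ge (norm_eval_le_of_no_zero_in_ball (r := r) ?_ (hD ε) fun a ha => ?_)
    · exact (mem_ball_iff_norm.mp hz).le
    · by_contra! hlt
      exact h a (mem_ball_iff_norm'.mpr hlt) ha

theorem diffOp_sum_C_mul (k : ℕ) (Q : ℕ → ℂ[X]) (s : Finset ℕ) (c : ℕ → ℂ) (P : ℕ → ℂ[X]) :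
    diffOp k Q (∑ m ∈ s, C (c m) * P m) = ∑ m ∈ s, C (c m) * diffOp k Q (P m) := by
  simp only [diffOp, iterate_derivative_sum, iterate_derivative_C_mul, Finset.mul_sum]
  rw [Finset.sum_comm]
  exact Finset.sum_congr rfl fun _ _ => Finset.sum_congr rfl fun _ _ => by ring

theorem Polynomial.mul_one_sub_C_mul_X_pow (p : ℂ[X]) (n : ℕ) (ε : ℂ) :
    p * (1 - C ε * X) ^ n =
      ∑ m ∈ Finset.range (n + 1), C (ε ^ m) * (p * ((-X) ^ m * (n.choose m : ℂ[X]))) := by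
  rw [show (1 - C ε * X : ℂ[X]) = C ε * (-X) + 1 by ring, add_pow, Finset.mul_sum]
  refine Finset.sum_congr rfl fun m _ => ?_
  rw [mul_pow, one_pow, C_pow]
  ring

theorem unbounded_TGe_invariant_is_T_invariant (k : ℕ) (hk : 1 ≤ k) (Q : ℕ → Polynomial ℂ)
    (hQk : Q k ≠ 0) (n : ℕ) (S : Set ℂ) (hSclosed : IsClosed S)
    (hSunbounded : ¬ Bornology.IsBounded S)
    (hSinv : TGeInvariant (diffOp k Q) n S) :
    ∀ m : ℕ, TGeInvariant (diffOp k Q) m S := by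
  intro m p hp _ hpS
  by_contra! ⟨hT, w, hw, hwS⟩
  obtain ⟨r, hr, hball⟩ := Metric.isOpen_iff.mp hSclosed.isOpen_compl w hwS
  let P : ℕ → ℂ[X] := fun m => p * ((-X) ^ m * (n.choose m : ℂ[X]))
  have hP0 : P 0 = p := by simp [P]
  obtain ⟨δ, hδ, hnear⟩ := Metric.eventually_nhds_iff.mp
    (exists_zero_near_of_family n (fun m => diffOp k Q (P m)) (by rwa [hP0]) (by rwa [hP0]) hr)
  obtain ⟨s, hsS, hs⟩ : ∃ s ∈ S, δ⁻¹ < ‖s‖ := by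
    by_contra! h
    exact hSunbounded (isBounded_iff_forall_norm_le.mpr ⟨_, h⟩)
  have hs0 : s ≠ 0 := norm_pos_iff.mp ((inv_pos.mpr hδ).trans hs)
  have hdist : dist s⁻¹ 0 < δ := by
    rw [dist_zero_right, norm_inv]
    exact inv_lt_of_inv_lt₀ hδ hs
  obtain ⟨hne, a, haball, ha⟩ := hnear hdist
  rw [← diffOp_sum_C_mul, ← mul_one_sub_C_mul_X_pow] at hne ha
  have hdeg : (1 - C s⁻¹ * X : ℂ[X]).natDegree = 1 := by
    rw [show (1 - C s⁻¹ * X : ℂ[X]) = C (-s⁻¹) * X + C 1 by simp; ring]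
    exact natDegree_linear (neg_ne_zero.mpr (inv_ne_zero hs0))
  have hlin : (1 - C s⁻¹ * X : ℂ[X]) ≠ 0 := fun h => by simp [h] at hdeg
  refine (hSinv _ (mul_ne_zero hp (pow_ne_zero n hlin)) ?_ fun z hz => ?_).elim hne
    fun h => hball haball (h a ha)
  · rw [natDegree_mul hp (pow_ne_zero n hlin), natDegree_pow, hdeg]
    lia
  · rw [eval_mul, mul_eq_zero] at hz
    refine hz.elim (hpS z) fun hz => ?_
    have hz1 : 1 - s⁻¹ * z = 0 := by
      rw [eval_pow] at hz
      simpa using eq_zero_of_pow_eq_zero hz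
    have : z = s :=
      ((inv_mul_eq_one₀ hs0).mp (sub_eq_zero.mp hz1).symm).symm
    rwa [this]
end

section
/- Let k ≥ 1 and let Q_0, …, Q_k ∈ ℂ[x] with deg Q_k ≥ 1, and let T(p) = ∑_{j=0}^k Q_j · p^{(j)}. Then for every integer n ≥ 0, every nonempty closed T_{≥n}-invariant set S ⊆ ℂ contains the convex hull of the set of complex zeros of Q_k. -/
open Polynomial

open Filter Topology

/-- Coefficientwise convergence of a sequence of complex polynomials of bounded degree. -/
def PolyTendsto (P : ℕ → Polynomial ℂ) (L : Polynomial ℂ) : Prop :=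
  (∃ D : ℕ, ∀ m, (P m).natDegree ≤ D) ∧
    ∀ i, Tendsto (fun m => (P m).coeff i) atTop (𝓝 (L.coeff i))

namespace PolyTendsto

variable {P R : ℕ → Polynomial ℂ} {L M : Polynomial ℂ}

lemma const (L : Polynomial ℂ) : PolyTendsto (fun _ => L) L :=
  ⟨⟨L.natDegree, fun _ => le_rfl⟩, fun _ => tendsto_const_nhds⟩

lemma add (hP : PolyTendsto P L) (hR : PolyTendsto R M) :
    PolyTendsto (fun m => P m + R m) (L + M) := by
  obtain ⟨⟨D, hD⟩, h⟩ := hP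
  obtain ⟨⟨E, hE⟩, h'⟩ := hR
  refine ⟨⟨max D E, fun m => (natDegree_add_le _ _).trans (max_le_max (hD m) (hE m))⟩, fun i => ?_⟩
  simpa only [coeff_add] using (h i).add (h' i)

lemma sum {ι : Type*} (s : Finset ι) {P : ι → ℕ → Polynomial ℂ} {L : ι → Polynomial ℂ}
    (h : ∀ i ∈ s, PolyTendsto (P i) (L i)) :
    PolyTendsto (fun m => ∑ i ∈ s, P i m) (∑ i ∈ s, L i) := by
  classical
  induction s using Finset.induction_on with
  | empty => simpa using const 0
  | insert a s ha ih =>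
    simp only [Finset.sum_insert ha]
    exact (h a (Finset.mem_insert_self a s)).add
      (ih fun i hi => h i (Finset.mem_insert_of_mem hi))

lemma const_mul (A : Polynomial ℂ) (hP : PolyTendsto P L) :
    PolyTendsto (fun m => A * P m) (A * L) := by
  obtain ⟨⟨D, hD⟩, h⟩ := hP
  refine ⟨⟨A.natDegree + D, fun m => natDegree_mul_le.trans (by gcongr; exact hD m)⟩,
    fun i => ?_⟩
  simp only [coeff_mul]
  exact tendsto_finsetSum _ fun x _ => (h x.2).const_mul _

lemma C_mul {c : ℕ → ℂ} {c' : ℂ} (hc : Tendsto c atTop (𝓝 c')) (hP : PolyTendsto P L) :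
    PolyTendsto (fun m => C (c m) * P m) (C c' * L) := by
  obtain ⟨⟨D, hD⟩, h⟩ := hP
  refine ⟨⟨D, fun m => (natDegree_C_mul_le _ _).trans (hD m)⟩, fun i => ?_⟩
  simpa only [coeff_C_mul] using hc.mul (h i)

lemma derivative (hP : PolyTendsto P L) :
    PolyTendsto (fun m => Polynomial.derivative (P m)) (Polynomial.derivative L) := by
  obtain ⟨⟨D, hD⟩, h⟩ := hP
  refine ⟨⟨D, fun m => (natDegree_derivative_le _).trans ((Nat.sub_le _ _).trans (hD m))⟩,
    fun i => ?_⟩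
  simpa only [coeff_derivative] using (h (i + 1)).mul_const _

lemma eval (hP : PolyTendsto P L) (z : ℂ) :
    Tendsto (fun m => (P m).eval z) atTop (𝓝 (L.eval z)) := by
  obtain ⟨⟨D, hD⟩, h⟩ := hP
  have hm (m) : (P m).eval z = ∑ i ∈ Finset.range (max D L.natDegree + 1), (P m).coeff i * z ^ i :=
    eval_eq_sum_range' (Nat.lt_succ_of_le ((hD m).trans (le_max_left _ _))) z
  rw [eval_eq_sum_range' (Nat.lt_succ_of_le (le_max_right D L.natDegree)) z]
  simp only [hm]
  exact tendsto_finsetSum _ fun i _ => (h i).mul_const _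

end PolyTendsto

/-- A polynomial without zeros in the ball of radius `ε` about `w` grows by at most a factor
`2 ^ deg` between `w` and any point of that ball. -/
lemma norm_eval_le_of_forall_root_dist (P : Polynomial ℂ) {w z : ℂ} {ε : ℝ}
    (hroot : ∀ x, P ≠ 0 → P.eval x = 0 → ε ≤ ‖w - x‖) (hz : ‖z - w‖ ≤ ε) :
    ‖P.eval z‖ ≤ 2 ^ P.natDegree * ‖P.eval w‖ := by
  by_cases hP : P = 0
  · simp [hP]
  have hs := IsAlgClosed.splits P
  rw [hs.natDegree_eq_card_roots, hs.eval_eq_prod_roots, hs.eval_eq_prod_roots, norm_mul, norm_mul,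
    mul_left_comm]
  refine mul_le_mul_of_nonneg_left ?_ (norm_nonneg _)
  have key : ∀ s : Multiset ℂ, (∀ x ∈ s, ε ≤ ‖w - x‖) →
      ‖(s.map fun a => z - a).prod‖ ≤ 2 ^ s.card * ‖(s.map fun a => w - a).prod‖ := by
    intro s
    induction s using Multiset.induction_on with
    | empty => simp
    | cons a s ih =>
      intro h
      have h1 := ih fun x hx => h x (Multiset.mem_cons_of_mem hx)
      have h2 : ‖z - a‖ ≤ 2 * ‖w - a‖ := by
        have h3 := norm_add_le (z - w) (w - a)
        rw [sub_add_sub_cancel] at h3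
        linarith [h a (Multiset.mem_cons_self a s)]
      simp only [Multiset.map_cons, Multiset.prod_cons, norm_mul, Multiset.card_cons]
      calc _ ≤ (2 * ‖w - a‖) * (2 ^ s.card * ‖(s.map fun a => w - a).prod‖) := by gcongr
        _ = _ := by ring
  exact key _ fun x hx => hroot x hP ((mem_roots hP).1 hx)

/-- A weak form of Hurwitz's theorem: zeros of a nonzero limit are limits of zeros. -/
lemma PolyTendsto.mem_of_eval_eq_zero {P : ℕ → Polynomial ℂ} {L : Polynomial ℂ}
    (hP : PolyTendsto P L) (hL : L ≠ 0) {S : Set ℂ} (hS : IsClosed S)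
    (hroot : ∀ᶠ m in atTop, P m ≠ 0 → ∀ z, (P m).eval z = 0 → z ∈ S) {w : ℂ}
    (hw : L.eval w = 0) : w ∈ S := by
  by_contra hwS
  obtain ⟨ε, hε, hball⟩ := Metric.isOpen_iff.1 hS.isOpen_compl w hwS
  obtain ⟨D, hD⟩ := hP.1
  refine hL (eq_zero_of_infinite_isRoot L
    ((infinite_of_mem_nhds w (Metric.ball_mem_nhds w hε)).mono fun z hz => ?_))
  have hlim : Tendsto (fun m => 2 ^ D * ‖(P m).eval w‖) atTop (𝓝 0) := by
    simpa [hw] using (hP.eval w).norm.const_mul (2 ^ D : ℝ)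
  have hle : ‖L.eval z‖ ≤ 0 := by
    refine le_of_tendsto_of_tendsto (hP.eval z).norm hlim ?_
    filter_upwards [hroot] with m hm
    refine (norm_eval_le_of_forall_root_dist (P m) (fun x h0 hx => ?_)
      (mem_ball_iff_norm.1 hz).le).trans ?_
    · by_contra! hlt
      refine hball (a := x) ?_ (hm h0 x hx)
      rwa [mem_ball_iff_norm, norm_sub_rev]
    · gcongr
      · norm_num
      · exact hD m
  exact norm_le_zero_iff.1 hle

/-- The normalized polynomial factor of the `j`-th derivative of `q ^ m`. -/
noncomputable def powDerivFactor (q : Polynomial ℂ) : ℕ → ℕ → Polynomial ℂ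
  | 0, _ => 1
  | j + 1, m => C (1 - (j : ℂ) * (m : ℂ)⁻¹) * (derivative q * powDerivFactor q j m) +
      C ((m : ℂ)⁻¹) * (q * derivative (powDerivFactor q j m))

lemma polyTendsto_powDerivFactor (q : Polynomial ℂ) (j : ℕ) :
    PolyTendsto (powDerivFactor q j) (derivative q ^ j) := by
  have hinv : Tendsto (fun m : ℕ => (m : ℂ)⁻¹) atTop (𝓝 0) :=
    tendsto_inv_atTop_nhds_zero_nat
  induction j with
  | zero => simpa [powDerivFactor] using PolyTendsto.const 1
  | succ j ih =>
    have h1 : Tendsto (fun m : ℕ => 1 - (j : ℂ) * (m : ℂ)⁻¹) atTop (𝓝 1) := by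
      simpa using (hinv.const_mul (j : ℂ)).const_sub 1
    have h := (PolyTendsto.C_mul h1 (ih.const_mul (derivative q))).add
      (PolyTendsto.C_mul hinv (ih.derivative.const_mul q))
    have e : C (1 : ℂ) * (derivative q * derivative q ^ j) +
        C 0 * (q * derivative (derivative q ^ j)) = derivative q ^ (j + 1) := by
      simp [pow_succ']
    rw [e] at h
    exact h

lemma iterate_derivative_pow_eq (q : Polynomial ℂ) {m : ℕ} (hm : m ≠ 0) (j : ℕ) :
    ∀ i, m = j + i → derivative^[j] (q ^ m) =
      C ((m : ℂ) ^ j) * (q ^ i * powDerivFactor q j m) := by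
  have hm' : (m : ℂ) ≠ 0 := Nat.cast_ne_zero.2 hm
  induction j with
  | zero => rintro i rfl; simp [powDerivFactor]
  | succ j ih =>
    intro i hi
    rw [Function.iterate_succ_apply', ih (i + 1) (by omega)]
    have e1 : C ((m : ℂ) ^ (j + 1)) * C (1 - (j : ℂ) * (m : ℂ)⁻¹) =
        C ((m : ℂ) ^ j) * C ((i : ℂ) + 1) := by
      rw [← C_mul, ← C_mul]
      congr 1
      have : (m : ℂ) = j + 1 + i := by exact_mod_cast hi
      have h2 : (i : ℂ) + 1 = m - j := by rw [this]; ring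
      rw [h2]
      field_simp
      ring
    have e2 : C ((m : ℂ) ^ (j + 1)) * C ((m : ℂ)⁻¹) = C ((m : ℂ) ^ j) := by
      rw [← C_mul]
      congr 1
      field_simp
      ring
    simp only [powDerivFactor, derivative_mul, derivative_C, zero_mul, zero_add,
      derivative_pow_succ]
    linear_combination (-(q ^ i * (derivative q * powDerivFactor q j m))) * e1
      - (q ^ i * (q * derivative (powDerivFactor q j m))) * e2

/-- The normalized polynomial factor of `diffOp k Q (q ^ m)`. -/
noncomputable def diffOpPowFactor (k : ℕ) (Q : ℕ → Polynomial ℂ) (q : Polynomial ℂ) (m : ℕ) :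
    Polynomial ℂ :=
  ∑ j ∈ Finset.range (k + 1),
    C ((m : ℂ)⁻¹ ^ (k - j)) * (Q j * q ^ (k - j) * powDerivFactor q j m)

lemma polyTendsto_diffOpPowFactor (k : ℕ) (Q : ℕ → Polynomial ℂ) (q : Polynomial ℂ) :
    PolyTendsto (diffOpPowFactor k Q q) (Q k * derivative q ^ k) := by
  have hinv : Tendsto (fun m : ℕ => (m : ℂ)⁻¹) atTop (𝓝 0) :=
    tendsto_inv_atTop_nhds_zero_nat
  have h := PolyTendsto.sum (Finset.range (k + 1)) fun j _ =>
    PolyTendsto.C_mul (hinv.pow (k - j))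
      ((polyTendsto_powDerivFactor q j).const_mul (Q j * q ^ (k - j)))
  have e : ∑ j ∈ Finset.range (k + 1),
      C ((0 : ℂ) ^ (k - j)) * (Q j * q ^ (k - j) * derivative q ^ j) =
        Q k * derivative q ^ k := by
    rw [Finset.sum_range_succ, Finset.sum_eq_zero]
    · simp
    · intro j hj
      have : k - j ≠ 0 := by have := Finset.mem_range.1 hj; omega
      simp [zero_pow this]
  rw [e] at h
  exact h

lemma diffOp_pow_eq (k : ℕ) (Q : ℕ → Polynomial ℂ) (q : Polynomial ℂ) {m : ℕ} (hm : m ≠ 0)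
    (hkm : k ≤ m) :
    diffOp k Q (q ^ m) = C ((m : ℂ) ^ k) * (q ^ (m - k) * diffOpPowFactor k Q q m) := by
  have hm' : (m : ℂ) ≠ 0 := Nat.cast_ne_zero.2 hm
  rw [diffOp, diffOpPowFactor, Finset.mul_sum, Finset.mul_sum]
  refine Finset.sum_congr rfl fun j hj => ?_
  have hj : j ≤ k := Nat.lt_succ_iff.1 (Finset.mem_range.1 hj)
  obtain ⟨d, rfl⟩ := Nat.exists_eq_add_of_le hj
  rw [iterate_derivative_pow_eq q hm j (m - (j + d) + d) (by omega), Nat.add_sub_cancel_left]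
  have e : C ((m : ℂ) ^ (j + d)) * C ((m : ℂ)⁻¹ ^ d) = C ((m : ℂ) ^ j) := by
    rw [← C_mul]
    congr 1
    rw [pow_add, mul_assoc, ← mul_pow, mul_inv_cancel₀ hm', one_pow, mul_one]
  rw [← e, pow_add]
  ring

/-- A closed invariant set containing the zeros of a nonconstant `q` contains the zeros of
`Q k * q'`. -/
lemma TGeInvariant.mem_of_eval_mul_derivative {k : ℕ} (hk : 1 ≤ k) {Q : ℕ → Polynomial ℂ}
    (hQk : Q k ≠ 0) {n : ℕ} {S : Set ℂ} (hS : IsClosed S)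
    (hinv : TGeInvariant (diffOp k Q) n S) {q : Polynomial ℂ} (hq : 1 ≤ q.natDegree)
    (hqS : ∀ z, q.eval z = 0 → z ∈ S) {w : ℂ} (hw : (Q k * derivative q).eval w = 0) :
    w ∈ S := by
  have hq0 : q ≠ 0 := by rintro rfl; simp at hq
  have hq' : derivative q ≠ 0 := fun h => by
    have := derivative_eq_zero.1 h
    omega
  refine (polyTendsto_diffOpPowFactor k Q q).mem_of_eval_eq_zero
    (mul_ne_zero hQk (pow_ne_zero _ hq')) hS ?_ (w := w) ?_
  · filter_upwards [eventually_ge_atTop (max 1 (max n k))] with m hm h0 z hz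
    have hm1 : m ≠ 0 := by omega
    have hT := diffOp_pow_eq k Q q hm1 (by omega)
    rcases hinv (q ^ m) (pow_ne_zero _ hq0)
      (by rw [natDegree_pow]; nlinarith [le_max_right 1 (max n k), le_max_left n k])
      (fun x hx => hqS x (by rw [eval_pow] at hx; exact eq_zero_of_pow_eq_zero hx)) with h | h
    · rw [hT] at h
      exact absurd h (mul_ne_zero (C_ne_zero.2 (pow_ne_zero _ (Nat.cast_ne_zero.2 hm1)))
        (mul_ne_zero (pow_ne_zero _ hq0) h0))
    · exact h z (by rw [hT]; simp [hz])
  · rw [eval_mul, mul_eq_zero] at hw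
    rcases hw with h | h
    · simp [h]
    · simp [h, show k ≠ 0 by omega]

/-- A closed set that contains the rational points of all segments with endpoints in it
is convex. -/
lemma IsClosed.convex_of_natCast_combo {S : Set ℂ} (hS : IsClosed S)
    (h : ∀ a ∈ S, ∀ b ∈ S, ∀ r s : ℕ, r ≠ 0 → s ≠ 0 →
      ((r : ℂ) * b + s * a) / (r + s) ∈ S) : Convex ℝ S := by
  rw [convex_iff_forall_pos]
  intro b hb a ha α β hα hβ hαβ
  have hlim (γ : ℝ) (hγ : 0 < γ) :
      Tendsto (fun m : ℕ => ((⌈γ * m⌉₊ / m : ℝ) : ℂ)) atTop (𝓝 (γ : ℂ)) :=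
    (Complex.continuous_ofReal.tendsto γ).comp
      ((tendsto_nat_ceil_mul_div_atTop hγ.le).comp tendsto_natCast_atTop_atTop)
  have hne : (α : ℂ) + β ≠ 0 := by rw [← Complex.ofReal_add, hαβ]; simp
  have h1 := (((hlim α hα).mul_const b).add ((hlim β hβ).mul_const a)).div
    ((hlim α hα).add (hlim β hβ)) hne
  have e : ((α : ℂ) * b + β * a) / (α + β) = α • b + β • a := by
    rw [← Complex.ofReal_add, hαβ]; simp
  rw [e] at h1
  refine hS.mem_of_tendsto h1 ?_
  filter_upwards [eventually_gt_atTop 0] with m hm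
  have hm' : (0 : ℝ) < m := Nat.cast_pos.2 hm
  have hmC : (m : ℂ) ≠ 0 := Nat.cast_ne_zero.2 hm.ne'
  convert h a ha b hb ⌈α * m⌉₊ ⌈β * m⌉₊ (Nat.ceil_pos.2 (mul_pos hα hm')).ne'
    (Nat.ceil_pos.2 (mul_pos hβ hm')).ne' using 1
  simp only [Pi.div_apply]
  push_cast
  rw [← mul_div_mul_right _ _ hmC]
  congr 1 <;> field_simp

theorem TGe_invariant_contains_fundamental_polygon (k : ℕ) (hk : 1 ≤ k)
    (Q : ℕ → Polynomial ℂ) (hQk : 1 ≤ (Q k).natDegree) (n : ℕ) (S : Set ℂ)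
    (hSne : S.Nonempty) (hSclosed : IsClosed S)
    (hSinv : TGeInvariant (diffOp k Q) n S) :
    convexHull ℝ {z : ℂ | (Q k).eval z = 0} ⊆ S := by
  have hQ0 : Q k ≠ 0 := by rintro h; simp [h] at hQk
  refine convexHull_min (fun z hz => ?_)
    (hSclosed.convex_of_natCast_combo fun a ha b hb r s hr hs => ?_)
  · obtain ⟨a, ha⟩ := hSne
    refine hSinv.mem_of_eval_mul_derivative hk hQ0 hSclosed (q := X - C a)
      (natDegree_X_sub_C a).ge (fun x hx => ?_) (w := z) ?_
    · rw [eval_sub, eval_X, eval_C, sub_eq_zero] at hx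
      exact hx ▸ ha
    · rw [eval_mul, show (Q k).eval z = 0 from hz, zero_mul]
  · obtain ⟨r, rfl⟩ := Nat.exists_eq_succ_of_ne_zero hr
    obtain ⟨s, rfl⟩ := Nat.exists_eq_succ_of_ne_zero hs
    refine hSinv.mem_of_eval_mul_derivative hk hQ0 hSclosed
      (q := (X - C a) ^ (r + 1) * (X - C b) ^ (s + 1)) ?_ (fun x hx => ?_) ?_
    · rw [natDegree_mul (pow_ne_zero _ (X_sub_C_ne_zero a)) (pow_ne_zero _ (X_sub_C_ne_zero b)),
        natDegree_pow, natDegree_pow, natDegree_X_sub_C, natDegree_X_sub_C]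
      omega
    · rw [eval_mul, mul_eq_zero] at hx
      simp only [eval_pow, eval_sub, eval_X, eval_C] at hx
      rcases hx with hx | hx
      · exact sub_eq_zero.1 (eq_zero_of_pow_eq_zero hx) ▸ ha
      · exact sub_eq_zero.1 (eq_zero_of_pow_eq_zero hx) ▸ hb
    · have hne : ((r + 1 : ℕ) : ℂ) + (s + 1 : ℕ) ≠ 0 := by
        exact_mod_cast (by omega : (r + 1) + (s + 1) ≠ 0)
      obtain ⟨w, hw⟩ : ∃ w, w = (((r + 1 : ℕ) : ℂ) * b + (s + 1 : ℕ) * a) /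
        ((r + 1 : ℕ) + (s + 1 : ℕ)) := ⟨_, rfl⟩
      have hw' := (eq_div_iff hne).1 hw
      simp only [Nat.succ_eq_add_one, ← hw]
      push_cast at hw'
      simp only [eval_mul, eval_add, derivative_mul, derivative_pow_succ, derivative_sub,
        derivative_X, derivative_C, eval_pow, eval_sub, eval_X, eval_C, eval_one, eval_zero]
      linear_combination ((Q k).eval w * (w - a) ^ r * (w - b) ^ s) * hw'
end

section
/- Let k ≥ 1 and let Q_0, …, Q_k ∈ ℂ[x] with Q_k ≠ 0, let T(p) = ∑_{j=0}^k Q_j · p^{(j)}, and assume T is non-degenerate, i.e. deg Q_j − j ≤ deg Q_k − k for all 0 ≤ j ≤ k with Q_j ≠ 0. Let D = {z ∈ ℂ : |z − c| ≤ r} be a closed disk with r > 0 such that every complex zero of Q_k lies in the open disk {z : |z − c| < r}. Then there exists a positive integer N such that for every integer n ≥ N the disk D is T_n-invariant. -/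
open Polynomial

/-- A set `S ⊆ ℂ` is `T_n`-invariant: for every nonzero polynomial `p` with `deg p = n`
all of whose zeros lie in `S`, either `T p = 0` or all zeros of `T p` lie in `S`. -/
def TnInvariant (T : Polynomial ℂ → Polynomial ℂ) (n : ℕ) (S : Set ℂ) : Prop :=
  ∀ p : Polynomial ℂ, p ≠ 0 → p.natDegree = n → (∀ z : ℂ, p.eval z = 0 → z ∈ S) →
    T p = 0 ∨ ∀ z : ℂ, (T p).eval z = 0 → z ∈ S

/-- `T` is non-degenerate: `deg Q_j − j ≤ deg Q_k − k` for all `0 ≤ j ≤ k` with `Q_j ≠ 0`. -/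
def NonDegenerate (k : ℕ) (Q : ℕ → Polynomial ℂ) : Prop :=
  ∀ j ≤ k, Q j ≠ 0 → ((Q j).natDegree : ℤ) - j ≤ ((Q k).natDegree : ℤ) - k

/-- If `v` is no longer than `u`, then the real part of `u / (u - v)` is at least `1 / 2`. -/
lemma half_le_re_div_sub {u v : ℂ} (hv : ‖v‖ ≤ ‖u‖) (huv : u - v ≠ 0) :
    1 / 2 ≤ (u / (u - v)).re := by
  have hpos : 0 < Complex.normSq (u - v) := Complex.normSq_pos.mpr huv
  have hsq : Complex.normSq v ≤ Complex.normSq u := by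
    rw [Complex.normSq_eq_norm_sq, Complex.normSq_eq_norm_sq]
    gcongr
  rw [Complex.div_re, ← add_div, le_div_iff₀ hpos]
  simp only [Complex.normSq_apply, Complex.sub_re, Complex.sub_im] at hsq ⊢
  nlinarith

/-- Outside a closed disk containing all zeros of `q`, the logarithmic derivative of `q` is at
least `deg q / (2 |z - c|)` in absolute value. -/
lemma natDegree_mul_norm_eval_le {q : ℂ[X]} {c : ℂ} {r : ℝ}
    (hq : ∀ w : ℂ, q.eval w = 0 → w ∈ Metric.closedBall c r)
    {z : ℂ} (hz : z ∉ Metric.closedBall c r) :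
    (q.natDegree : ℝ) * ‖q.eval z‖ ≤ 2 * ‖z - c‖ * ‖q.derivative.eval z‖ := by
  have hqz : q.eval z ≠ 0 := fun h => hz (hq z h)
  have hsplit : q.Splits := IsAlgClosed.splits q
  have hlog := hsplit.eval_derivative_div_eval_of_ne_zero hqz
  have hsum : ∀ s : Multiset ℂ, (∀ a ∈ s, a ∈ Metric.closedBall c r) →
      (s.card : ℝ) / 2 ≤ ((z - c) * (s.map fun a => 1 / (z - a)).sum).re := by
    intro s
    induction s using Multiset.induction_on with
    | empty => simp
    | cons a s ih =>
      intro hs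
      have hrest := ih fun b hb => hs b (Multiset.mem_cons_of_mem hb)
      have ha := hs a (Multiset.mem_cons_self a s)
      have hza : z - a ≠ 0 := by
        rw [sub_ne_zero]
        rintro rfl
        exact hz ha
      rw [mem_closedBall_iff_norm] at ha hz
      have hhalf := half_le_re_div_sub (u := z - c) (v := a - c) (by linarith) (by simpa using hza)
      rw [sub_sub_sub_cancel_right] at hhalf
      rw [Multiset.map_cons, Multiset.sum_cons, Multiset.card_cons, mul_add, Complex.add_re,
        mul_one_div]
      push_cast
      linarith
  have hre := hsum q.roots fun a ha => hq a (isRoot_of_mem_roots ha)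
  rw [← hsplit.natDegree_eq_card_roots, ← hlog] at hre
  have hnorm := hre.trans (Complex.re_le_norm _)
  rw [norm_mul, norm_div, ← mul_div_assoc, le_div_iff₀ (norm_pos_iff.mpr hqz)] at hnorm
  linarith

/-- A closed disk containing the zeros of a nonconstant `q` contains those of its derivative. -/
lemma derivative_zero_mem_closedBall {q : ℂ[X]} {c : ℂ} {r : ℝ} (hdeg : 0 < q.natDegree)
    (hq : ∀ w : ℂ, q.eval w = 0 → w ∈ Metric.closedBall c r) (z : ℂ)
    (hz : q.derivative.eval z = 0) : z ∈ Metric.closedBall c r := by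
  by_contra hzc
  have h := natDegree_mul_norm_eval_le hq hzc
  have hqz : q.eval z ≠ 0 := fun h => hzc (hq z h)
  have : 0 < (q.natDegree : ℝ) * ‖q.eval z‖ := by positivity
  rw [hz, norm_zero, mul_zero] at h
  linarith

lemma natDegree_iterate_derivative_eq (p : ℂ[X]) (j : ℕ) :
    (derivative^[j] p).natDegree = p.natDegree - j := by
  induction j with
  | zero => simp
  | succ j ih => rw [Function.iterate_succ_apply', natDegree_derivative, ih, Nat.sub_sub]

lemma iterate_derivative_zero_mem_closedBall {p : ℂ[X]} {c : ℂ} {r : ℝ}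
    (hp : ∀ w : ℂ, p.eval w = 0 → w ∈ Metric.closedBall c r) {j : ℕ} (hj : j ≤ p.natDegree)
    (z : ℂ) (hz : (derivative^[j] p).eval z = 0) : z ∈ Metric.closedBall c r := by
  induction j generalizing z with
  | zero => exact hp z hz
  | succ j ih =>
    rw [Function.iterate_succ_apply'] at hz
    refine derivative_zero_mem_closedBall ?_ (ih (by lia)) z hz
    rw [natDegree_iterate_derivative_eq]
    lia

/-- Outside a closed disk containing the zeros of `p`, lower derivatives are controlled by the
higher ones. -/
lemma pow_mul_norm_iterate_derivative_le {p : ℂ[X]} {c : ℂ} {r : ℝ}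
    (hp : ∀ w : ℂ, p.eval w = 0 → w ∈ Metric.closedBall c r)
    {z : ℂ} (hz : z ∉ Metric.closedBall c r) {m j i : ℕ} (hdeg : m + (j + i) ≤ p.natDegree) :
    (m : ℝ) ^ i * ‖(derivative^[j] p).eval z‖ ≤
      (2 * ‖z - c‖) ^ i * ‖(derivative^[j + i] p).eval z‖ := by
  induction i with
  | zero => simp
  | succ i ih =>
    have hstep := natDegree_mul_norm_eval_le
      (iterate_derivative_zero_mem_closedBall hp (j := j + i) (by lia)) hz
    rw [natDegree_iterate_derivative_eq, ← Function.iterate_succ_apply' derivative] at hstep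
    have hm : (m : ℝ) ≤ ((p.natDegree - (j + i) : ℕ) : ℝ) := by exact_mod_cast (by lia)
    calc (m : ℝ) ^ (i + 1) * ‖(derivative^[j] p).eval z‖
        = m * ((m : ℝ) ^ i * ‖(derivative^[j] p).eval z‖) := by ring
      _ ≤ m * ((2 * ‖z - c‖) ^ i * ‖(derivative^[j + i] p).eval z‖) :=
          mul_le_mul_of_nonneg_left (ih (by lia)) (by positivity)
      _ = (2 * ‖z - c‖) ^ i * (m * ‖(derivative^[j + i] p).eval z‖) := by ring
      _ ≤ (2 * ‖z - c‖) ^ i *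
          ((p.natDegree - (j + i) : ℕ) * ‖(derivative^[j + i] p).eval z‖) := by gcongr
      _ ≤ (2 * ‖z - c‖) ^ i * (2 * ‖z - c‖ * ‖(derivative^[j + (i + 1)] p).eval z‖) :=
          mul_le_mul_of_nonneg_left hstep (by positivity)
      _ = _ := by ring

/-- A nonzero polynomial whose zeros lie in an open disk grows outside it at least like a
multiple of `|z - c| ^ deg`. -/
lemma exists_pos_mul_pow_le_norm_eval {B : ℂ[X]} (hB : B ≠ 0) {c : ℂ} {r : ℝ} (hr : 0 < r)
    (hroots : ∀ z : ℂ, B.eval z = 0 → z ∈ Metric.ball c r) :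
    ∃ δ : ℝ, 0 < δ ∧ ∀ z : ℂ, r ≤ ‖z - c‖ → δ * ‖z - c‖ ^ B.natDegree ≤ ‖B.eval z‖ := by
  have hprod : ∀ s : Multiset ℂ, (∀ a ∈ s, a ∈ Metric.ball c r) → ∃ δ : ℝ, 0 < δ ∧
      ∀ z : ℂ, r ≤ ‖z - c‖ → δ * ‖z - c‖ ^ s.card ≤ ‖(s.map (z - ·)).prod‖ := by
    intro s
    induction s using Multiset.induction_on with
    | empty => exact fun _ => ⟨1, one_pos, by simp⟩
    | cons a s ih =>
      intro hs
      obtain ⟨δ, hδ, hle⟩ := ih fun b hb => hs b (Multiset.mem_cons_of_mem hb)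
      have ha := hs a (Multiset.mem_cons_self a s)
      rw [mem_ball_iff_norm] at ha
      have hfactor : 0 < 1 - ‖a - c‖ / r := by
        rw [sub_pos, div_lt_one hr]
        exact ha
      refine ⟨(1 - ‖a - c‖ / r) * δ, mul_pos hfactor hδ, fun z hz => ?_⟩
      have hza : (1 - ‖a - c‖ / r) * ‖z - c‖ ≤ ‖z - a‖ := by
        have htri := norm_sub_norm_le (z - c) (a - c)
        rw [sub_sub_sub_cancel_right] at htri
        have hscale : ‖a - c‖ ≤ ‖a - c‖ / r * ‖z - c‖ := by
          rw [div_mul_eq_mul_div, le_div_iff₀ hr]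
          gcongr
        linarith
      rw [Multiset.map_cons, Multiset.prod_cons, Multiset.card_cons, norm_mul]
      calc (1 - ‖a - c‖ / r) * δ * ‖z - c‖ ^ (s.card + 1)
          = ((1 - ‖a - c‖ / r) * ‖z - c‖) * (δ * ‖z - c‖ ^ s.card) := by ring
        _ ≤ _ := by
          gcongr
          exact hle z hz
  obtain ⟨δ, hδ, hle⟩ := hprod B.roots fun a ha => hroots a (isRoot_of_mem_roots ha)
  have hlead : 0 < ‖B.leadingCoeff‖ := norm_pos_iff.mpr (leadingCoeff_ne_zero.mpr hB)
  have hsplit : B.Splits := IsAlgClosed.splits B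
  refine ⟨‖B.leadingCoeff‖ * δ, mul_pos hlead hδ, fun z hz => ?_⟩
  rw [hsplit.eval_eq_prod_roots, norm_mul, hsplit.natDegree_eq_card_roots, mul_assoc]
  gcongr
  exact hle z hz

/-- A polynomial of degree at most `d` is `O(|z - c| ^ d)` away from `c`. -/
lemma exists_norm_eval_le_mul_pow (A : ℂ[X]) {d : ℕ} (hd : A.natDegree ≤ d) (c : ℂ) {r : ℝ}
    (hr : 0 < r) :
    ∃ M : ℝ, 0 ≤ M ∧ ∀ z : ℂ, r ≤ ‖z - c‖ → ‖A.eval z‖ ≤ M * ‖z - c‖ ^ d := by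
  refine ⟨∑ i ∈ Finset.range (d + 1), ‖(taylor c A).coeff i‖ / r ^ (d - i),
    Finset.sum_nonneg fun i _ => by positivity, fun z hz => ?_⟩
  have hlt : (taylor c A).natDegree < d + 1 := by
    rw [natDegree_taylor]
    lia
  rw [← taylor_eval_sub c A z, eval_eq_sum_range' hlt, Finset.sum_mul]
  refine (norm_sum_le _ _).trans (Finset.sum_le_sum fun i hi => ?_)
  have hid : i ≤ d := by
    rw [Finset.mem_range] at hi
    lia
  rw [norm_mul, norm_pow, div_mul_eq_mul_div, le_div_iff₀ (by positivity), mul_assoc]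
  gcongr
  calc ‖z - c‖ ^ i * r ^ (d - i) ≤ ‖z - c‖ ^ i * ‖z - c‖ ^ (d - i) := by gcongr
    _ = ‖z - c‖ ^ d := by rw [← pow_add, Nat.add_sub_cancel' hid]

/-- Outside a disk containing the zeros of `B`, a polynomial of degree at most `deg B` is bounded
by a multiple of `B`. -/
lemma exists_norm_eval_le_mul_norm_eval {A B : ℂ[X]} (hB : B ≠ 0)
    (hdeg : A.natDegree ≤ B.natDegree) {c : ℂ} {r : ℝ} (hr : 0 < r)
    (hroots : ∀ z : ℂ, B.eval z = 0 → z ∈ Metric.ball c r) :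
    ∃ M : ℝ, 0 ≤ M ∧ ∀ z : ℂ, r ≤ ‖z - c‖ → ‖A.eval z‖ ≤ M * ‖B.eval z‖ := by
  obtain ⟨δ, hδ, hlow⟩ := exists_pos_mul_pow_le_norm_eval hB hr hroots
  obtain ⟨M, hM, hup⟩ := exists_norm_eval_le_mul_pow A hdeg c hr
  refine ⟨M / δ, by positivity, fun z hz => (hup z hz).trans ?_⟩
  rw [div_mul_eq_mul_div, le_div_iff₀ hδ, mul_assoc, mul_comm _ δ]
  gcongr
  exact hlow z hz

/-- For a non-degenerate operator, `Q_j (z - c) ^ (k - j)` is bounded by a multiple of `Q_k`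
outside a disk containing the zeros of `Q_k`. -/
lemma NonDegenerate.exists_norm_eval_mul_pow_le {k : ℕ} {Q : ℕ → ℂ[X]} (hnd : NonDegenerate k Q)
    (hQk : Q k ≠ 0) {c : ℂ} {r : ℝ} (hr : 0 < r)
    (hroots : ∀ z : ℂ, (Q k).eval z = 0 → z ∈ Metric.ball c r) {j : ℕ} (hj : j ≤ k) :
    ∃ M : ℝ, 0 ≤ M ∧ ∀ z : ℂ, r ≤ ‖z - c‖ →
      ‖(Q j).eval z‖ * ‖z - c‖ ^ (k - j) ≤ M * ‖(Q k).eval z‖ := by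
  have hdeg : (Q j * (X - C c) ^ (k - j)).natDegree ≤ (Q k).natDegree := by
    by_cases hQj : Q j = 0
    · simp [hQj]
    · have hle := hnd j hj hQj
      rw [natDegree_mul hQj (pow_ne_zero _ (X_sub_C_ne_zero c)), natDegree_pow, natDegree_X_sub_C]
      lia
  obtain ⟨M, hM, hle⟩ := exists_norm_eval_le_mul_norm_eval hQk hdeg hr hroots
  exact ⟨M, hM, fun z hz => by simpa using hle z hz⟩

theorem nondegenerate_disk_invariant (k : ℕ) (hk : 1 ≤ k) (Q : ℕ → Polynomial ℂ)
    (hQk : Q k ≠ 0) (hnd : NonDegenerate k Q) (c : ℂ) (r : ℝ) (hr : 0 < r)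
    (hroots : ∀ z : ℂ, (Q k).eval z = 0 → z ∈ Metric.ball c r) :
    ∃ N : ℕ, 0 < N ∧ ∀ n : ℕ, N ≤ n →
      TnInvariant (diffOp k Q) n (Metric.closedBall c r) := by
  have hbound : ∀ j : ℕ, ∃ M : ℝ, 0 ≤ M ∧ (j ≤ k → ∀ z : ℂ, r ≤ ‖z - c‖ →
      ‖(Q j).eval z‖ * ‖z - c‖ ^ (k - j) ≤ M * ‖(Q k).eval z‖) := by
    intro j
    by_cases hj : j ≤ k
    · obtain ⟨M, hM, hle⟩ := hnd.exists_norm_eval_mul_pow_le hQk hr hroots hj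
      exact ⟨M, hM, fun _ => hle⟩
    · exact ⟨0, le_rfl, fun h => absurd h hj⟩
  choose M hM hle using hbound
  set S : ℝ := ∑ j ∈ Finset.range k, M j * 2 ^ (k - j) with hS
  obtain ⟨m, hm⟩ := exists_nat_gt S
  have hS0 : 0 ≤ S := Finset.sum_nonneg fun j _ => mul_nonneg (hM j) (by positivity)
  have hm0 : (0 : ℝ) < m := hS0.trans_lt hm
  have hm1 : (1 : ℝ) ≤ m := by exact_mod_cast (Nat.cast_pos.mp hm0)
  refine ⟨m + k, by lia, fun n hn p _ hpn hp => Or.inr fun z hTz => ?_⟩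
  by_contra hz
  have hzr : r ≤ ‖z - c‖ := by
    rw [mem_closedBall_iff_norm, not_le] at hz
    exact hz.le
  have hQz : (Q k).eval z ≠ 0 := fun h => hz (Metric.ball_subset_closedBall (hroots z h))
  have hpz : (derivative^[k] p).eval z ≠ 0 := fun h =>
    hz (iterate_derivative_zero_mem_closedBall hp (by lia) z h)
  set W : ℝ := ‖(Q k).eval z‖ * ‖(derivative^[k] p).eval z‖ with hW
  have hWpos : 0 < W := by positivity
  have hterm : ∀ j ∈ Finset.range k,
      m * ‖(Q j * derivative^[j] p).eval z‖ ≤ M j * 2 ^ (k - j) * W := by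
    intro j hj
    rw [Finset.mem_range] at hj
    have hder := pow_mul_norm_iterate_derivative_le hp hz (m := m) (j := j) (i := k - j) (by lia)
    rw [Nat.add_sub_cancel' hj.le, mul_pow] at hder
    rw [eval_mul, norm_mul]
    calc (m : ℝ) * (‖(Q j).eval z‖ * ‖(derivative^[j] p).eval z‖)
        ≤ (m : ℝ) ^ (k - j) * (‖(Q j).eval z‖ * ‖(derivative^[j] p).eval z‖) := by
          gcongr
          exact le_self_pow₀ hm1 (by lia)
      _ = ‖(Q j).eval z‖ * ((m : ℝ) ^ (k - j) * ‖(derivative^[j] p).eval z‖) := by ring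
      _ ≤ ‖(Q j).eval z‖ *
          (2 ^ (k - j) * ‖z - c‖ ^ (k - j) * ‖(derivative^[k] p).eval z‖) := by gcongr
      _ = (‖(Q j).eval z‖ * ‖z - c‖ ^ (k - j)) *
          (2 ^ (k - j) * ‖(derivative^[k] p).eval z‖) := by ring
      _ ≤ (M j * ‖(Q k).eval z‖) * (2 ^ (k - j) * ‖(derivative^[k] p).eval z‖) :=
          mul_le_mul_of_nonneg_right (hle j hj.le z hzr) (by positivity)
      _ = M j * 2 ^ (k - j) * W := by ring
  have hW_le : W ≤ ∑ j ∈ Finset.range k, ‖(Q j * derivative^[j] p).eval z‖ := by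
    rw [diffOp, Finset.sum_range_succ, eval_add, add_comm, add_eq_zero_iff_eq_neg] at hTz
    rw [hW, ← norm_mul, ← eval_mul, hTz, norm_neg, eval_finsetSum]
    exact norm_sum_le _ _
  have hmW : m * W ≤ S * W := by
    calc m * W ≤ m * ∑ j ∈ Finset.range k, ‖(Q j * derivative^[j] p).eval z‖ := by gcongr
      _ ≤ S * W := by
        rw [Finset.mul_sum, hS, Finset.sum_mul]
        exact Finset.sum_le_sum hterm
  exact absurd (le_of_mul_le_mul_right hmW hWpos) (not_le.mpr hm)
end

section
/- Let k ≥ 1 and let Q_0, …, Q_k ∈ ℂ[x] with Q_k ≠ 0, let T(p) = ∑_{j=0}^k Q_j · p^{(j)}, and let a, b ∈ ℂ with a ≠ 0. Consider the closed half-plane H = {a z + b : z ∈ ℂ, Im z ≤ 0}. Then the following are equivalent: (1) the set of nonnegative integers n for which H is T_n-invariant is infinite; (2) H is T_n-invariant for every integer n ≥ 0; (3) the two-variable polynomial F(x,y) = ∑_{j=0}^k Q_j(a x + b) · (−y/a)^j is stable, i.e. F(x,y) ≠ 0 whenever Im x > 0 and Im y > 0. -/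
open Polynomial

open Filter Topology

/-- A polynomial without zeros in the ball of radius `r` about `c` grows in a controlled way
away from `c`. -/
lemma norm_eval_le_of_eval_ne_zero_on_ball {P : ℂ[X]} {d : ℕ} (hd : P.natDegree ≤ d)
    {c : ℂ} {r : ℝ} (hr : 0 < r) (hP : ∀ x ∈ Metric.ball c r, P.eval x ≠ 0) (x : ℂ) :
    ‖P.eval x‖ ≤ (1 + ‖x - c‖ / r) ^ d * ‖P.eval c‖ := by
  have hs := IsAlgClosed.splits P
  have key : ∀ s : Multiset ℂ, (∀ z ∈ s, r ≤ ‖c - z‖) →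
      ‖(s.map (fun z => x - z)).prod‖ ≤
        (1 + ‖x - c‖ / r) ^ s.card * ‖(s.map (fun z => c - z)).prod‖ := by
    intro s
    induction s using Multiset.induction_on with
    | empty => simp
    | cons z s ih =>
      intro h
      have hz : r ≤ ‖c - z‖ := h z (by simp)
      have ih' := ih fun w hw => h w (by simp [hw])
      have h1 : ‖x - z‖ ≤ (1 + ‖x - c‖ / r) * ‖c - z‖ := by
        have h2 : ‖x - z‖ ≤ ‖x - c‖ + ‖c - z‖ := by
          simpa using norm_add_le (x - c) (c - z)
        have h3 : ‖x - c‖ ≤ ‖x - c‖ / r * ‖c - z‖ := by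
          rw [div_mul_eq_mul_div, le_div_iff₀ hr]
          gcongr
        linarith
      simp only [Multiset.map_cons, Multiset.prod_cons, norm_mul, Multiset.card_cons]
      calc _ ≤ ((1 + ‖x - c‖ / r) * ‖c - z‖) *
            ((1 + ‖x - c‖ / r) ^ s.card * ‖(s.map (fun z => c - z)).prod‖) := by gcongr
        _ = _ := by ring
  have hroots : ∀ z ∈ P.roots, r ≤ ‖c - z‖ := by
    intro z hz
    by_contra! hlt
    refine hP z ?_ (Polynomial.isRoot_of_mem_roots hz)
    rwa [Metric.mem_ball, dist_comm, dist_eq_norm]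
  rw [hs.eval_eq_prod_roots x, hs.eval_eq_prod_roots c, norm_mul, norm_mul]
  have hcard : (1 + ‖x - c‖ / r) ^ P.roots.card ≤ (1 + ‖x - c‖ / r) ^ d := by
    apply pow_le_pow_right₀
    · have : 0 ≤ ‖x - c‖ / r := by positivity
      linarith
    · exact (Polynomial.card_roots' P).trans hd
  calc _ ≤ ‖P.leadingCoeff‖ * ((1 + ‖x - c‖ / r) ^ d *
        ‖(P.roots.map (fun z => c - z)).prod‖) := by
        gcongr
        exact (key _ hroots).trans (by gcongr)
    _ = _ := by ring

/-- Hurwitz's theorem for polynomials of bounded degree: a pointwise limit of polynomials without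
zeros in a ball that vanishes at the centre of the ball vanishes identically. -/
lemma eq_zero_of_tendsto_of_eval_ne_zero_on_ball {ι : Type*} {l : Filter ι} [l.NeBot]
    {P : ι → ℂ[X]} {R : ℂ[X]} {d : ℕ} (hd : ∀ i, (P i).natDegree ≤ d)
    (hlim : ∀ x, Tendsto (fun i => (P i).eval x) l (𝓝 (R.eval x)))
    {c : ℂ} {r : ℝ} (hr : 0 < r)
    (hP : ∀ᶠ i in l, ∀ x ∈ Metric.ball c r, (P i).eval x ≠ 0) (hc : R.eval c = 0) :
    R = 0 := by
  refine Polynomial.funext fun x => ?_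
  have h : ‖R.eval x‖ ≤ (1 + ‖x - c‖ / r) ^ d * ‖R.eval c‖ :=
    le_of_tendsto_of_tendsto (hlim x).norm ((hlim c).norm.const_mul _)
      (hP.mono fun i hi => norm_eval_le_of_eval_ne_zero_on_ball (hd i) hr hi x)
  rw [hc, norm_zero, mul_zero] at h
  simpa using h

/-- If `q` has no zeros in the image of the open upper half-plane under `ξ ↦ a ξ + b`, then
neither has `q' - r q` when `0 < Im (a r)`. -/
lemma eval_derivative_sub_ne_zero {a b : ℂ} (ha : a ≠ 0) {q : ℂ[X]}
    (hq : ∀ ξ : ℂ, 0 < ξ.im → q.eval (a * ξ + b) ≠ 0) {r : ℂ} (hr : 0 < (a * r).im)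
    {ξ : ℂ} (hξ : 0 < ξ.im) : (derivative q - C r * q).eval (a * ξ + b) ≠ 0 := by
  have hx := hq ξ hξ
  have hdiv := (IsAlgClosed.splits q).eval_derivative_div_eval_of_ne_zero hx
  have key : ∀ s : Multiset ℂ, (∀ z ∈ s, q.eval z = 0) →
      (a * (s.map fun z => 1 / (a * ξ + b - z)).sum).im ≤ 0 := by
    intro s
    induction s using Multiset.induction_on with
    | empty => simp
    | cons z s ih =>
      intro h
      have ih' := ih fun w hw => h w (by simp [hw])
      rw [Multiset.map_cons, Multiset.sum_cons, mul_add, Complex.add_im]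
      obtain ⟨ζ, rfl⟩ : ∃ ζ, z = a * ζ + b := ⟨(z - b) / a, by field_simp; ring⟩
      have hζ : ζ.im ≤ 0 := by
        by_contra! hlt
        exact hq ζ hlt (h _ (by simp))
      have h1 : a * (1 / (a * ξ + b - (a * ζ + b))) = (ξ - ζ)⁻¹ := by
        rw [show a * ξ + b - (a * ζ + b) = a * (ξ - ζ) by ring, one_div, mul_inv,
          mul_inv_cancel_left₀ ha]
      have h2 : ((ξ - ζ)⁻¹).im ≤ 0 := by
        rw [Complex.inv_im]
        apply div_nonpos_of_nonpos_of_nonneg _ (Complex.normSq_nonneg _)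
        simp only [Complex.sub_im]
        linarith
      rw [h1]
      linarith
  have h1 := key q.roots fun z hz => Polynomial.isRoot_of_mem_roots hz
  rw [← hdiv] at h1
  intro h0
  simp only [eval_sub, eval_mul, eval_C, sub_eq_zero] at h0
  rw [h0, mul_div_cancel_right₀ _ hx] at h1
  linarith

/-- The operator `D + t` on polynomials, where `D` is differentiation. -/
noncomputable def derivativeAdd (t : ℂ) : Module.End ℂ ℂ[X] :=
  derivative + t • 1

lemma derivativeAdd_apply (t : ℂ) (p : ℂ[X]) : derivativeAdd t p = derivative p + C t * p := by
  simp [derivativeAdd, Polynomial.smul_eq_C_mul]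

lemma eval_aeval_derivativeAdd_prod_ne_zero {a b t : ℂ} (ha : a ≠ 0) (ht : (a * t).im < 0)
    {p : ℂ[X]} (hp : ∀ ξ : ℂ, 0 < ξ.im → p.eval (a * ξ + b) ≠ 0) (s : Multiset ℂ)
    (hs : ∀ r ∈ s, 0 ≤ (a * r).im) :
    ∀ ξ : ℂ, 0 < ξ.im →
      (aeval (derivativeAdd t) (s.map fun r => X - C r).prod p).eval (a * ξ + b) ≠ 0 := by
  induction s using Multiset.induction_on with
  | empty => simpa using hp
  | cons r s ih =>
    intro ξ hξ
    have ih' := ih fun w hw => hs w (by simp [hw])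
    have hr : 0 < (a * (r - t)).im := by
      have := hs r (by simp)
      rw [mul_sub, Complex.sub_im]
      linarith
    have h := eval_derivative_sub_ne_zero ha ih' hr hξ
    convert h using 2
    rw [Multiset.map_cons, Multiset.prod_cons, map_mul, Module.End.mul_apply]
    simp only [map_sub, aeval_X, aeval_C, LinearMap.sub_apply, derivativeAdd_apply,
      Module.algebraMap_end_apply, Polynomial.smul_eq_C_mul]
    ring

lemma continuous_coeff_derivativeAdd_pow (p : ℂ[X]) (j n : ℕ) :
    Continuous fun t : ℂ => ((derivativeAdd t ^ j) p).coeff n := by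
  induction j generalizing n with
  | zero => simpa using continuous_const
  | succ j ih =>
    simp only [pow_succ', Module.End.mul_apply, derivativeAdd_apply, coeff_add, coeff_C_mul,
      coeff_derivative]
    have h1 := ih n
    have h2 := ih (n + 1)
    fun_prop

lemma natDegree_derivativeAdd_pow_le (t : ℂ) (p : ℂ[X]) (j : ℕ) :
    ((derivativeAdd t ^ j) p).natDegree ≤ p.natDegree := by
  induction j with
  | zero => simp
  | succ j ih =>
    rw [pow_succ', Module.End.mul_apply, derivativeAdd_apply]
    refine (natDegree_add_le _ _).trans (max_le ?_ ?_)
    · exact (natDegree_derivative_le _).trans ((Nat.sub_le _ _).trans ih)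
    · exact (natDegree_C_mul_le _ _).trans ih

lemma continuous_eval_derivativeAdd_pow (p : ℂ[X]) (j : ℕ) (x : ℂ) :
    Continuous fun t : ℂ => ((derivativeAdd t ^ j) p).eval x := by
  have h : ∀ t, ((derivativeAdd t ^ j) p).eval x =
      ∑ i ∈ Finset.range (p.natDegree + 1), ((derivativeAdd t ^ j) p).coeff i * x ^ i := fun t =>
    eval_eq_sum_range' (Nat.lt_succ_of_le (natDegree_derivativeAdd_pow_le t p j)) x
  simp only [h]
  exact continuous_finsetSum _ fun i _ =>
    (continuous_coeff_derivativeAdd_pow p j i).mul continuous_const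

/-- The symbol of `diffOp k Q` at the point `x`, as a polynomial in the variable that stands for
differentiation. -/
noncomputable def diffSymbol (k : ℕ) (Q : ℕ → ℂ[X]) (x : ℂ) : ℂ[X] :=
  ∑ j ∈ Finset.range (k + 1), C ((Q j).eval x) * X ^ j

lemma eval_diffSymbol (k : ℕ) (Q : ℕ → ℂ[X]) (x s : ℂ) :
    (diffSymbol k Q x).eval s = ∑ j ∈ Finset.range (k + 1), (Q j).eval x * s ^ j := by
  simp [diffSymbol, eval_finsetSum]

/-- The operator obtained from `diffOp k Q` by replacing differentiation `D` by `D + t`. -/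
noncomputable def shiftedDiffOp (k : ℕ) (Q : ℕ → ℂ[X]) (t : ℂ) (p : ℂ[X]) : ℂ[X] :=
  ∑ j ∈ Finset.range (k + 1), Q j * (derivativeAdd t ^ j) p

lemma shiftedDiffOp_zero (k : ℕ) (Q : ℕ → ℂ[X]) (p : ℂ[X]) :
    shiftedDiffOp k Q 0 p = diffOp k Q p := by
  simp [shiftedDiffOp, diffOp, derivativeAdd, Module.End.pow_apply]

lemma eval_shiftedDiffOp (k : ℕ) (Q : ℕ → ℂ[X]) (t : ℂ) (p : ℂ[X]) (x : ℂ) :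
    (shiftedDiffOp k Q t p).eval x =
      (aeval (derivativeAdd t) (diffSymbol k Q x) p).eval x := by
  simp [shiftedDiffOp, diffSymbol, eval_finsetSum, map_sum, LinearMap.sum_apply]

lemma exists_natDegree_shiftedDiffOp_le (k : ℕ) (Q : ℕ → ℂ[X]) (p : ℂ[X]) :
    ∃ d, ∀ t, (shiftedDiffOp k Q t p).natDegree ≤ d := by
  refine ⟨(Finset.range (k + 1)).sup (fun j => (Q j).natDegree) + p.natDegree, fun t => ?_⟩
  refine natDegree_sum_le_of_forall_le _ _ fun j hj => natDegree_mul_le.trans ?_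
  gcongr
  · exact Finset.le_sup (f := fun j => (Q j).natDegree) hj
  · exact natDegree_derivativeAdd_pow_le t p j

/-- A differential operator with stable symbol maps a polynomial that has no zeros in the image of
the open upper half-plane to `0` or to such a polynomial. -/
lemma diffOp_eq_zero_or_eval_ne_zero {k : ℕ} {Q : ℕ → ℂ[X]} {a b : ℂ} (ha : a ≠ 0)
    (hF : ∀ x y : ℂ, 0 < x.im → 0 < y.im →
      (∑ j ∈ Finset.range (k + 1), (Q j).eval (a * x + b) * (-y / a) ^ j) ≠ 0)
    {p : ℂ[X]} (hp : ∀ ξ : ℂ, 0 < ξ.im → p.eval (a * ξ + b) ≠ 0) :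
    diffOp k Q p = 0 ∨ ∀ ξ : ℂ, 0 < ξ.im → (diffOp k Q p).eval (a * ξ + b) ≠ 0 := by
  by_contra! hcon
  obtain ⟨hne, ξ₀, hξ₀, h0⟩ := hcon
  apply hne
  have hshift : ∀ t : ℂ, (a * t).im < 0 → ∀ ξ : ℂ, 0 < ξ.im →
      (shiftedDiffOp k Q t p).eval (a * ξ + b) ≠ 0 := by
    intro t ht ξ hξ
    set g := diffSymbol k Q (a * ξ + b) with hg
    have hgne : ∀ s : ℂ, (a * s).im < 0 → g.eval s ≠ 0 := by
      intro s hs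
      rw [hg, eval_diffSymbol]
      convert hF ξ (-(a * s)) hξ (by rwa [Complex.neg_im, neg_pos]) using 4
      field_simp
    have hg0 : g ≠ 0 := by
      intro h
      exact hgne t ht (by rw [h, eval_zero])
    rw [eval_shiftedDiffOp, ← hg, (IsAlgClosed.splits g).eq_prod_roots, map_mul,
      Module.End.mul_apply, aeval_C, Module.algebraMap_end_apply, eval_smul, smul_eq_mul]
    refine mul_ne_zero (leadingCoeff_ne_zero.mpr hg0)
      (eval_aeval_derivativeAdd_prod_ne_zero ha ht hp _ (fun r hr => ?_) ξ hξ)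
    by_contra! hlt
    exact hgne r hlt (isRoot_of_mem_roots hr)
  obtain ⟨d, hd⟩ := exists_natDegree_shiftedDiffOp_le k Q p
  set t : ℝ → ℂ := fun ε => -(ε * Complex.I) / a with ht
  have htneg : ∀ ε : ℝ, 0 < ε → (a * t ε).im < 0 := by
    intro ε hε
    simp only [ht]
    rw [mul_div_cancel₀ _ ha]
    simpa using hε
  have htcont : Continuous t := by
    simp only [ht]
    fun_prop
  have hr : 0 < ‖a‖ * ξ₀.im := mul_pos (norm_pos_iff.mpr ha) hξ₀
  refine eq_zero_of_tendsto_of_eval_ne_zero_on_ball (l := 𝓝[>] (0 : ℝ))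
    (P := fun ε => shiftedDiffOp k Q (t ε) p) (fun ε => hd _) (fun x => ?_) hr ?_ h0
  · have hcont : Continuous fun ε : ℝ => (shiftedDiffOp k Q (t ε) p).eval x := by
      simp only [shiftedDiffOp, eval_finsetSum, eval_mul]
      exact continuous_finsetSum _ fun j _ =>
        continuous_const.mul ((continuous_eval_derivativeAdd_pow p j x).comp htcont)
    have h := (hcont.tendsto 0).mono_left (nhdsWithin_le_nhds (s := Set.Ioi 0))
    have ht0 : t 0 = 0 := by simp [ht]
    rwa [ht0, shiftedDiffOp_zero] at h
  · filter_upwards [self_mem_nhdsWithin] with ε hε x hx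
    obtain ⟨ζ, rfl⟩ : ∃ ζ, x = a * ζ + b := ⟨(x - b) / a, by field_simp; ring⟩
    refine hshift _ (htneg ε hε) ζ ?_
    rw [Metric.mem_ball, dist_eq_norm, show a * ζ + b - (a * ξ₀ + b) = a * (ζ - ξ₀) by ring,
      norm_mul] at hx
    have h1 := lt_of_mul_lt_mul_left hx (norm_nonneg a)
    have h2 := (abs_le.mp (Complex.abs_im_le_norm (ζ - ξ₀))).1
    rw [Complex.sub_im] at h2
    linarith

/-- `diffOp k Q` as a linear map. -/
noncomputable def diffOpLinear (k : ℕ) (Q : ℕ → ℂ[X]) : Module.End ℂ ℂ[X] :=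
  ∑ j ∈ Finset.range (k + 1), LinearMap.mulLeft ℂ (Q j) * derivative ^ j

lemma diffOpLinear_apply (k : ℕ) (Q : ℕ → ℂ[X]) (p : ℂ[X]) :
    diffOpLinear k Q p = diffOp k Q p := by
  simp [diffOpLinear, diffOp, LinearMap.sum_apply, Module.End.pow_apply]

/-- Uniqueness for the initial value problem at a point where the leading coefficient does not
vanish. -/
lemma eq_zero_of_diffOp_eq_zero {k : ℕ} {Q : ℕ → ℂ[X]} {c : ℂ} (hc : (Q k).eval c ≠ 0)
    {p : ℂ[X]} (hT : diffOp k Q p = 0) (hp : ∀ j < k, (derivative^[j] p).eval c = 0) :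
    p = 0 := by
  by_contra hne
  set m := p.rootMultiplicity c with hm
  have hlow : ∀ j < m, (derivative^[j] p).IsRoot c := fun j hj =>
    (lt_rootMultiplicity_iff_isRoot_iterate_derivative hne).mp hj j le_rfl
  have hkm : k ≤ m := by
    by_contra! hlt
    exact lt_irrefl m ((lt_rootMultiplicity_iff_isRoot_iterate_derivative hne).mpr
      fun j hj => hp j (by omega))
  have hdvd : ∀ j < k, (X - C c) ^ (m - k + 1) ∣ Q j * derivative^[j] p := by
    intro j hj
    exact ((pow_dvd_pow _ (by omega : m - k + 1 ≤ m - j)).trans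
      (pow_sub_dvd_iterate_derivative_of_pow_dvd j (pow_rootMultiplicity_dvd p c))).mul_left _
  have htop : (X - C c) ^ (m - k + 1) ∣ Q k * derivative^[k] p := by
    rw [diffOp, Finset.sum_range_succ] at hT
    rw [eq_neg_of_add_eq_zero_right hT]
    exact (Finset.dvd_sum fun j hj => hdvd j (Finset.mem_range.mp hj)).neg_right
  have hcop : IsCoprime ((X - C c) ^ (m - k + 1)) (Q k) := by
    refine IsCoprime.pow_left ((irreducible_X_sub_C c).coprime_iff_not_dvd.mpr ?_)
    rwa [dvd_iff_isRoot]
  have h1 := pow_sub_dvd_iterate_derivative_of_pow_dvd (m - k) (hcop.dvd_of_dvd_mul_left htop)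
  rw [← Function.iterate_add_apply, Nat.sub_add_cancel hkm, Nat.add_sub_cancel_left, pow_one,
    dvd_iff_isRoot] at h1
  refine lt_irrefl m ((lt_rootMultiplicity_iff_isRoot_iterate_derivative hne).mpr fun j hj => ?_)
  rcases hj.lt_or_eq with hj | rfl
  · exact hlow j hj
  · exact h1

/-- The degrees of polynomial solutions of a linear differential equation are bounded. -/
lemma exists_natDegree_le_of_diffOp_eq_zero {k : ℕ} {Q : ℕ → ℂ[X]} (hQ : Q k ≠ 0) :
    ∃ N, ∀ p : ℂ[X], diffOp k Q p = 0 → p.natDegree ≤ N := by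
  obtain ⟨c, hc⟩ : ∃ c, (Q k).eval c ≠ 0 := by
    by_contra! h
    exact hQ (Polynomial.funext fun x => by simpa using h x)
  set K := LinearMap.ker (diffOpLinear k Q) with hK
  have hmem : ∀ p, p ∈ K ↔ diffOp k Q p = 0 := fun p => by
    rw [hK, LinearMap.mem_ker, diffOpLinear_apply]
  let φ : ℂ[X] →ₗ[ℂ] (Fin k → ℂ) := LinearMap.pi fun j =>
    Polynomial.leval c ∘ₗ (derivative ^ (j : ℕ) : Module.End ℂ ℂ[X])
  have hφ : ∀ p j, φ p j = (derivative^[j] p).eval c := fun p j => by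
    simp [φ, Module.End.pow_apply, Polynomial.leval]
  have hinj : Function.Injective (φ.domRestrict K) := by
    rw [injective_iff_map_eq_zero]
    rintro ⟨p, hp⟩ h
    refine Subtype.ext (eq_zero_of_diffOp_eq_zero hc ((hmem p).mp hp) fun j hj => ?_)
    rw [← hφ p ⟨j, hj⟩]
    exact congrFun h ⟨j, hj⟩
  have hfin : FiniteDimensional ℂ K := FiniteDimensional.of_injective _ hinj
  obtain ⟨S, hS⟩ := (Submodule.fg_iff_finiteDimensional K).mpr hfin
  refine ⟨S.sup natDegree, fun p hp => ?_⟩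
  rw [← hmem, ← hS] at hp
  induction hp using Submodule.span_induction with
  | mem x hx => exact Finset.le_sup (f := natDegree) hx
  | zero => simp
  | add x y _ _ hx hy => exact (natDegree_add_le _ _).trans (max_le hx hy)
  | smul r x _ hx => exact (natDegree_smul_le _ _).trans hx

lemma tendsto_descFactorial_div_pow_s9 (j : ℕ) :
    Tendsto (fun n : ℕ => (n.descFactorial j : ℂ) / (n : ℂ) ^ j) atTop (𝓝 1) := by
  have h := (isEquivalent_descFactorial j)
  rw [Asymptotics.isEquivalent_iff_tendsto_one] at h
  · have h' := (Complex.continuous_ofReal.tendsto 1).comp h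
    simpa [Function.comp_def, Pi.div_apply] using h'
  · filter_upwards [eventually_gt_atTop 0] with n hn
    positivity

/-- The action of `diffOp k Q` on a power of a linear polynomial. -/
lemma eval_diffOp_X_sub_C_pow {k n : ℕ} (hkn : k ≤ n) (Q : ℕ → ℂ[X]) {x w : ℂ} (hxw : x ≠ w) :
    (diffOp k Q ((X - C w) ^ n)).eval x = (x - w) ^ n *
      ∑ j ∈ Finset.range (k + 1), (Q j).eval x * n.descFactorial j * ((x - w)⁻¹) ^ j := by
  rw [diffOp, eval_finsetSum, Finset.mul_sum]
  refine Finset.sum_congr rfl fun j hj => ?_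
  have hjn : j ≤ n := (Nat.lt_succ_iff.mp (Finset.mem_range.mp hj)).trans hkn
  have hne : x - w ≠ 0 := sub_ne_zero.mpr hxw
  rw [iterate_derivative_X_sub_pow, eval_mul, eval_smul, eval_pow, eval_sub, eval_X, eval_C,
    nsmul_eq_mul, inv_pow, pow_sub₀ _ hne hjn]
  ring

lemma affine_mem_image_lowerHalfPlane_iff {a : ℂ} (ha : a ≠ 0) (b ξ : ℂ) :
    a * ξ + b ∈ (fun z : ℂ => a * z + b) '' {z : ℂ | z.im ≤ 0} ↔ ξ.im ≤ 0 := by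
  have hinj : Function.Injective fun z : ℂ => a * z + b := fun z w h =>
    mul_left_cancel₀ ha (add_right_cancel h)
  exact hinj.mem_set_image (s := {z : ℂ | z.im ≤ 0})

lemma forall_eval_eq_zero_mem_iff {a : ℂ} (ha : a ≠ 0) (b : ℂ) (p : ℂ[X]) :
    (∀ z, p.eval z = 0 → z ∈ (fun z : ℂ => a * z + b) '' {z : ℂ | z.im ≤ 0}) ↔
      ∀ ξ : ℂ, 0 < ξ.im → p.eval (a * ξ + b) ≠ 0 := by
  constructor
  · intro h ξ hξ h0
    exact absurd ((affine_mem_image_lowerHalfPlane_iff ha b ξ).mp (h _ h0)) (not_le.mpr hξ)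
  · intro h z hz
    obtain ⟨ξ, rfl⟩ : ∃ ξ, z = a * ξ + b := ⟨(z - b) / a, by field_simp; ring⟩
    rw [affine_mem_image_lowerHalfPlane_iff ha]
    by_contra! hlt
    exact h ξ hlt hz

/-- For a fixed point `x` and `y` in a ball whose closure lies in the upper half-plane,
the points `x + n / y` are eventually in the lower half-plane. -/
lemma eventually_im_add_natCast_div_nonpos (x : ℂ) {y₀ : ℂ} (hy₀ : 0 < y₀.im) :
    ∀ᶠ n : ℕ in atTop, ∀ y ∈ Metric.ball y₀ (y₀.im / 2), (x + n / y).im ≤ 0 := by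
  set M := (‖y₀‖ + y₀.im / 2) ^ 2 with hM
  have hMpos : 0 < M := by positivity
  have hlim : Tendsto (fun n : ℕ => (n : ℝ) * (y₀.im / 2 / M)) atTop atTop :=
    tendsto_natCast_atTop_atTop.atTop_mul_const (by positivity)
  filter_upwards [hlim.eventually_ge_atTop x.im] with n hn y hy
  rw [Metric.mem_ball, dist_eq_norm] at hy
  have h1 := (abs_le.mp (Complex.abs_im_le_norm (y - y₀))).1
  rw [Complex.sub_im] at h1
  have hyim : y₀.im / 2 ≤ y.im := by linarith
  have hynorm : ‖y‖ ≤ ‖y₀‖ + y₀.im / 2 := by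
    have := norm_add_le y₀ (y - y₀)
    rw [add_sub_cancel] at this
    linarith
  have hy0 : y ≠ 0 := by
    rintro rfl
    simp only [Complex.zero_im] at hyim
    linarith
  have hsq : Complex.normSq y ≤ M := by
    rw [Complex.normSq_eq_norm_sq, hM]
    gcongr
  have hpos : 0 < Complex.normSq y := Complex.normSq_pos.mpr hy0
  have h2 : (n / y : ℂ).im = -(n * (y.im / Complex.normSq y)) := by
    rw [div_eq_mul_inv, ← Complex.ofReal_natCast, Complex.im_ofReal_mul, Complex.inv_im]
    ring
  have h3 : y₀.im / 2 / M ≤ y.im / Complex.normSq y := by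
    have : 0 ≤ y.im := by linarith
    gcongr
  have h4 : (n : ℝ) * (y₀.im / 2 / M) ≤ n * (y.im / Complex.normSq y) := by gcongr
  rw [Complex.add_im, h2]
  linarith

/-- If a half-plane is `T_n`-invariant for infinitely many `n`, then the symbol of `T` is
stable. -/
lemma sum_ne_zero_of_infinite_TnInvariant {k : ℕ} {Q : ℕ → ℂ[X]} (hQk : Q k ≠ 0) {a b : ℂ}
    (ha : a ≠ 0)
    (hinf : {n : ℕ | TnInvariant (diffOp k Q) n
      ((fun z : ℂ => a * z + b) '' {z : ℂ | z.im ≤ 0})}.Infinite)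
    {x₀ y₀ : ℂ} (hx₀ : 0 < x₀.im) (hy₀ : 0 < y₀.im) :
    (∑ j ∈ Finset.range (k + 1), (Q j).eval (a * x₀ + b) * (-y₀ / a) ^ j) ≠ 0 := by
  intro h0
  obtain ⟨N, hN⟩ := exists_natDegree_le_of_diffOp_eq_zero hQk
  set S := {n : ℕ | TnInvariant (diffOp k Q) n
      ((fun z : ℂ => a * z + b) '' {z : ℂ | z.im ≤ 0})} with hS
  have hpow : ∀ n ∈ S, N < n → ∀ ω : ℂ, ω.im ≤ 0 →
      (diffOp k Q ((X - C (a * ω + b)) ^ n)).eval (a * x₀ + b) ≠ 0 := by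
    intro n hn hNn ω hω
    have hdeg : ((X - C (a * ω + b)) ^ n).natDegree = n := by
      rw [natDegree_pow, natDegree_X_sub_C, mul_one]
    rcases hn _ (pow_ne_zero _ (X_sub_C_ne_zero _)) hdeg (fun z hz => by
      have hz' : z = a * ω + b := by
        have hn0 : n ≠ 0 := by omega
        simpa [sub_eq_zero, hn0] using hz
      rw [hz', affine_mem_image_lowerHalfPlane_iff ha]
      exact hω) with h | h
    · have := hN _ h
      omega
    · exact (forall_eval_eq_zero_mem_iff ha b _).mp h x₀ hx₀
  have hfreq : ∃ᶠ n in atTop, n ∈ S := Nat.frequently_atTop_iff_infinite.mpr hinf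
  have : (atTop ⊓ 𝓟 S).NeBot := frequently_mem_iff_neBot.mp hfreq
  have hlarge : ∀ᶠ n in atTop ⊓ 𝓟 S, n ∈ S ∧ N < n ∧ k ≤ n :=
    (eventually_inf_principal.mpr (Eventually.of_forall fun n hn => hn)).and
      ((eventually_gt_atTop N).and (eventually_ge_atTop k) |>.filter_mono inf_le_left)
  set R : ℂ[X] := ∑ j ∈ Finset.range (k + 1),
    C ((Q j).eval (a * x₀ + b) * (-1 / a) ^ j) * X ^ j with hR
  set P : ℕ → ℂ[X] := fun n => ∑ j ∈ Finset.range (k + 1),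
    C ((Q j).eval (a * x₀ + b) * (-1 / a) ^ j * ((n.descFactorial j : ℂ) / (n : ℂ) ^ j)) * X ^ j
    with hP
  have hRzero : R = 0 := by
    refine eq_zero_of_tendsto_of_eval_ne_zero_on_ball (l := atTop ⊓ 𝓟 S) (P := P) (d := k)
      (c := y₀) (r := y₀.im / 2) (fun n => ?_) (fun y => ?_) (by positivity) ?_ ?_
    · refine natDegree_sum_le_of_forall_le _ _ fun j hj => ?_
      exact (natDegree_C_mul_X_pow_le _ _).trans (Nat.lt_succ_iff.mp (Finset.mem_range.mp hj))
    · refine Tendsto.mono_left ?_ inf_le_left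
      simp only [hP, hR, eval_finsetSum, eval_mul, eval_C, eval_pow, eval_X]
      refine tendsto_finsetSum _ fun j _ => Tendsto.mul_const _ ?_
      simpa using (tendsto_descFactorial_div_pow_s9 j).const_mul
        ((Q j).eval (a * x₀ + b) * (-1 / a) ^ j)
    · filter_upwards [hlarge,
        (eventually_im_add_natCast_div_nonpos x₀ hy₀).filter_mono inf_le_left,
        (eventually_gt_atTop 0).filter_mono inf_le_left] with n hn hω hn0 y hy hPy
      have hnC : (n : ℂ) ≠ 0 := by exact_mod_cast hn0.ne'
      have him := hω y hy
      have hy0 : y ≠ 0 := by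
        rintro rfl
        simp only [div_zero, add_zero] at him
        linarith
      apply hpow n hn.1 hn.2.1 _ him
      have hsub : a * x₀ + b - (a * (x₀ + n / y) + b) = -(a * n / y) := by ring
      have hne : a * x₀ + b ≠ a * (x₀ + n / y) + b := by
        rw [← sub_ne_zero, hsub]
        exact neg_ne_zero.mpr (div_ne_zero (mul_ne_zero ha hnC) hy0)
      rw [eval_diffOp_X_sub_C_pow hn.2.2 Q hne, hsub]
      refine mul_eq_zero_of_right _ (Eq.trans ?_ hPy)
      simp only [hP, eval_finsetSum, eval_mul, eval_C, eval_pow, eval_X]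
      refine Finset.sum_congr rfl fun j _ => ?_
      rw [show (-(a * n / y))⁻¹ = -1 / a * (y / n) by field_simp, mul_pow, div_pow y]
      ring
    · rw [hR, ← h0]
      simp only [eval_finsetSum, eval_mul, eval_C, eval_pow, eval_X]
      refine Finset.sum_congr rfl fun j _ => ?_
      rw [mul_assoc, ← mul_pow]
      congr 2
      ring
  have hQzero : ∀ j ∈ Finset.range (k + 1), (Q j).eval (a * x₀ + b) = 0 := by
    intro j hj
    have h := congrArg (fun p => coeff p j) hRzero
    simp only [hR, finsetSum_coeff, coeff_C_mul, coeff_X_pow, coeff_zero, mul_ite, mul_one,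
      mul_zero, Finset.sum_ite_eq, if_pos hj] at h
    exact (mul_eq_zero.mp h).resolve_right
      (pow_ne_zero _ (div_ne_zero (neg_ne_zero.mpr one_ne_zero) ha))
  obtain ⟨n, hnS, hNn, -⟩ := hlarge.exists
  apply hpow n hnS hNn 0 (by simp)
  rw [diffOp, eval_finsetSum]
  exact Finset.sum_eq_zero fun j hj => by rw [eval_mul, hQzero j hj, zero_mul]

theorem halfplane_invariance_tfae (k : ℕ) (hk : 1 ≤ k) (Q : ℕ → Polynomial ℂ)
    (hQk : Q k ≠ 0) (a b : ℂ) (ha : a ≠ 0)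
    (H : Set ℂ) (hH : H = (fun z : ℂ => a * z + b) '' {z : ℂ | z.im ≤ 0}) :
    List.TFAE
      [ {n : ℕ | TnInvariant (diffOp k Q) n H}.Infinite,
        ∀ n : ℕ, TnInvariant (diffOp k Q) n H,
        ∀ x y : ℂ, 0 < x.im → 0 < y.im →
          (∑ j ∈ Finset.range (k + 1), (Q j).eval (a * x + b) * (-y / a) ^ j) ≠ 0 ] := by
  subst hH
  tfae_have 2 → 1 := fun h => by
    simpa [h] using Set.infinite_univ
  tfae_have 1 → 3 := fun h x y hx hy => sum_ne_zero_of_infinite_TnInvariant hQk ha h hx hy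
  tfae_have 3 → 2 := fun h n p _ _ hp =>
    (diffOp_eq_zero_or_eval_ne_zero ha h ((forall_eval_eq_zero_mem_iff ha b p).mp hp)).imp_right
      (forall_eval_eq_zero_mem_iff ha b _).mpr
  tfae_finish
end

section
/- Let k ≥ 1, d ≥ 1, c ∈ ℂ with c ≠ 0, points x_1, …, x_d ∈ ℂ, and real numbers κ_1, …, κ_d ≥ 0. Set Q_k(x) = c·∏_{i=1}^d (x − x_i) and Q_{k−1}(x) = c·∑_{i=1}^d κ_i·∏_{j≠i} (x − x_j), and let T(p) = Q_k · p^{(k)} + Q_{k−1} · p^{(k−1)}. Then the convex hull K of {x_1, …, x_d} is T_{≥0}-invariant; consequently, for every integer n ≥ 0, K equals the intersection of all nonempty closed T_{≥n}-invariant subsets of ℂ, i.e. K is the minimal nonempty closed T_{≥n}-invariant set. -/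
open Polynomial

open Filter Topology

/-- A closed midpoint-convex set in a real normed space is convex. -/
theorem IsClosed.convex_of_forall_midpoint_mem {E : Type*} [NormedAddCommGroup E]
    [NormedSpace ℝ E] {S : Set E} (hS : IsClosed S)
    (h : ∀ a ∈ S, ∀ b ∈ S, midpoint ℝ a b ∈ S) : Convex ℝ S := by
  rw [convex_iff_segment_subset]
  intro a ha b hb
  rw [segment_eq_image_lineMap]
  rintro _ ⟨t, ht, rfl⟩
  set D : Set ℝ := {u | AffineMap.lineMap a b u ∈ S}
  have hD : IsClosed D := hS.preimage AffineMap.lineMap_continuous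
  obtain ⟨l, ⟨hlD, hl⟩, hlmax⟩ := (isCompact_Icc.inter_left hD).exists_isGreatest
    (⟨0, by simpa [D] using ha, le_rfl, ht.1⟩ : (D ∩ Set.Icc 0 t).Nonempty)
  obtain ⟨r, ⟨hrD, hr⟩, hrmin⟩ := (isCompact_Icc.inter_left hD).exists_isLeast
    (⟨1, by simpa [D] using hb, ht.2, le_rfl⟩ : (D ∩ Set.Icc t 1).Nonempty)
  have hmid : midpoint ℝ l r ∈ D := by
    have := h _ hlD _ hrD
    rwa [← AffineMap.map_midpoint] at this
  have hval : midpoint ℝ l r = (l + r) / 2 := by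
    rw [midpoint_eq_smul_add, smul_eq_mul]; simp; ring
  rw [hval] at hmid
  have hl1 := hl.1
  have hl2 := hl.2
  have hr1 := hr.1
  have hr2 := hr.2
  rcases le_total ((l + r) / 2) t with hle | hle
  · have := hlmax ⟨hmid, by linarith, hle⟩
    have : l = t := by linarith
    exact this ▸ hlD
  · have := hrmin ⟨hmid, hle, by linarith⟩
    have : r = t := by linarith
    exact this ▸ hrD

/-- A point outside a closed convex set `K ⊆ ℂ` can be separated from `K` in such a way that all
the reciprocals `1 / (z - w)`, `w ∈ K`, lie in a common open half-plane. -/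
theorem Complex.exists_forall_re_div_sub_pos {K : Set ℂ} (hK : Convex ℝ K) (hKc : IsClosed K)
    {z : ℂ} (hz : z ∉ K) : ∃ l : ℂ, ∀ w ∈ K, 0 < (l / (z - w)).re := by
  obtain ⟨f, u, hfK, hfz⟩ := geometric_hahn_banach_closed_point hK hKc hz
  refine ⟨⟨f 1, f Complex.I⟩, fun w hw => ?_⟩
  have hpos : 0 < f (z - w) := by
    rw [map_sub]
    linarith [hfK w hw]
  have hne : z - w ≠ 0 := by
    intro h0
    simp [h0] at hpos
  have hf : f (z - w) = (z - w).re * f 1 + (z - w).im * f Complex.I := by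
    conv_lhs => rw [← Complex.re_add_im (z - w)]
    have h1 : ((z - w).re : ℂ) = (z - w).re • (1 : ℂ) := by simp
    have h2 : ((z - w).im : ℂ) * Complex.I = (z - w).im • Complex.I := by simp
    rw [map_add, h1, h2, map_smul, map_smul]
    simp
  have hn := Complex.normSq_pos.2 hne
  rw [Complex.div_re, ← add_div]
  apply div_pos _ hn
  rw [hf] at hpos
  simp only at hpos ⊢
  linarith

/-- Zeros of a limit of polynomials of bounded degree whose top coefficients do not tend to zero
belong to any closed set that contains the zeros of the polynomials. -/
theorem IsClosed.mem_of_tendsto_eval_zero {S : Set ℂ} (hS : IsClosed S) {G : ℕ → ℂ[X]} {N : ℕ}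
    {l z : ℂ} (hdeg : ∀ m, (G m).natDegree ≤ N)
    (hlead : Tendsto (fun m => (G m).coeff N) atTop (𝓝 l)) (hl : l ≠ 0)
    (hz : Tendsto (fun m => (G m).eval z) atTop (𝓝 0))
    (hroots : ∀ᶠ m in atTop, G m ≠ 0 → ∀ w, (G m).eval w = 0 → w ∈ S) : z ∈ S := by
  by_contra hzS
  obtain ⟨r, hr, hball⟩ := Metric.isOpen_iff.1 hS.isOpen_compl z hzS
  have hbound : ∀ᶠ m in atTop, ‖(G m).coeff N‖ * r ^ N ≤ ‖(G m).eval z‖ := by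
    filter_upwards [hroots, hlead.eventually_ne hl] with m hm hcoeff
    have hG : G m ≠ 0 := by
      rintro h0
      simp [h0] at hcoeff
    have hN : (G m).natDegree = N := le_antisymm (hdeg m) (le_natDegree_of_ne_zero hcoeff)
    have hsplit : (G m).Splits := IsAlgClosed.splits _
    have hcard : (G m).roots.card = N := by rw [← hN, hsplit.natDegree_eq_card_roots]
    have hfar : ∀ w ∈ (G m).roots, r ≤ ‖z - w‖ := by
      intro w hw
      by_contra! hlt
      refine hball (show w ∈ Metric.ball z r from ?_) (hm hG w (isRoot_of_mem_roots hw))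
      rwa [mem_ball_iff_norm, norm_sub_rev]
    have hprod : r ^ N ≤ ((G m).roots.map fun w => ‖z - w‖).prod := by
      have := Multiset.prod_map_le_prod_map₀ (s := (G m).roots) (fun _ => r) (fun w => ‖z - w‖)
        (fun _ _ => hr.le) hfar
      simpa [hcard] using this
    have heval : ‖(G m).eval z‖ =
        ‖(G m).coeff N‖ * ((G m).roots.map fun w => ‖z - w‖).prod := by
      rw [hsplit.eval_eq_prod_roots, norm_mul, leadingCoeff, hN]
      congr 1
      have := map_multiset_prod (normHom : ℂ →*₀ ℝ) ((G m).roots.map fun w => z - w)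
      simpa [Multiset.map_map, Function.comp_def] using this
    rw [heval]
    gcongr
  have hle := le_of_tendsto_of_tendsto ((hlead.norm).mul_const (r ^ N)) hz.norm hbound
  have : 0 < ‖l‖ * r ^ N := by positivity
  simp at hle
  linarith

namespace Polynomial

/-- For `ε = 1 / m`, the cofactor of `m ^ j * W ^ (m - j)` in the `j`-th derivative
of `W ^ m`; it depends polynomially on `ε`. -/
noncomputable def powDerivCofactor (W : ℂ[X]) (ε : ℂ) : ℕ → ℂ[X]
  | 0 => 1
  | j + 1 => C (1 - j * ε) * derivative W * powDerivCofactor W ε j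
      + C ε * W * derivative (powDerivCofactor W ε j)

theorem iterate_derivative_pow_eq (W : ℂ[X]) {m : ℕ} (hm : m ≠ 0) {j : ℕ} (hj : j ≤ m) :
    derivative^[j] (W ^ m) =
      C ((m : ℂ) ^ j) * W ^ (m - j) * powDerivCofactor W (m : ℂ)⁻¹ j := by
  induction j with
  | zero => simp [powDerivCofactor]
  | succ j ih =>
    obtain ⟨i, rfl⟩ : ∃ i, m = j + 1 + i := ⟨m - (j + 1), by omega⟩
    have hm' : ((j + 1 + i : ℕ) : ℂ) ≠ 0 := by exact_mod_cast hm
    set M : ℂ := ((j + 1 + i : ℕ) : ℂ) with hM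
    have hMi : M = j + 1 + i := by simp [hM]
    have h1 : (C (1 - j * M⁻¹) : ℂ[X]) * C M = C ((i : ℂ) + 1) := by
      rw [← C_mul]
      congr 1
      field_simp
      rw [hMi]
      ring
    have h2 : (C M⁻¹ : ℂ[X]) * C M = 1 := by
      rw [← C_mul, inv_mul_cancel₀ hm', C_1]
    rw [Function.iterate_succ_apply', ih (by omega), show j + 1 + i - j = i + 1 by omega,
      show j + 1 + i - (j + 1) = i by omega]
    simp only [powDerivCofactor, derivative_mul, derivative_C, derivative_pow, C_pow]
    rw [pow_succ (C M) j]
    push_cast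
    linear_combination (-(C M ^ j * W ^ i * derivative W * powDerivCofactor W M⁻¹ j)) * h1
      - (C M ^ j * W ^ i * W * derivative (powDerivCofactor W M⁻¹ j)) * h2

theorem powDerivCofactor_zero (W : ℂ[X]) (j : ℕ) :
    powDerivCofactor W 0 j = derivative W ^ j := by
  induction j with
  | zero => rfl
  | succ j ih => simp [powDerivCofactor, ih, pow_succ']

theorem natDegree_powDerivCofactor_le {W : ℂ[X]} (hW : W.natDegree ≤ 2) (ε : ℂ) (j : ℕ) :
    (powDerivCofactor W ε j).natDegree ≤ j := by
  induction j with
  | zero => simp [powDerivCofactor]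
  | succ j ih =>
    have hW' : (derivative W).natDegree ≤ 1 := (natDegree_derivative_le W).trans (by omega)
    have h1 : (C (1 - j * ε) * derivative W).natDegree ≤ 1 := (natDegree_C_mul_le _ _).trans hW'
    have h2 : (C ε * W).natDegree ≤ 2 := (natDegree_C_mul_le _ _).trans hW
    rw [powDerivCofactor]
    apply natDegree_add_le_of_degree_le
    · exact (natDegree_mul_le_of_le h1 ih).trans (by omega)
    · rcases j with _ | j
      · simp [powDerivCofactor]
      · exact (natDegree_mul_le_of_le h2 ((natDegree_derivative_le _).trans
          (Nat.sub_le_sub_right ih 1))).trans (by omega)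

theorem continuous_coeff_mul {Y : Type*} [TopologicalSpace Y] {f g : Y → ℂ[X]}
    (hf : ∀ n, Continuous fun y => (f y).coeff n) (hg : ∀ n, Continuous fun y => (g y).coeff n)
    (n : ℕ) : Continuous fun y => (f y * g y).coeff n := by
  simp only [coeff_mul]
  exact continuous_finsetSum _ fun i _ => (hf i.1).mul (hg i.2)

theorem continuous_coeff_powDerivCofactor (W : ℂ[X]) (j n : ℕ) :
    Continuous fun ε => (powDerivCofactor W ε j).coeff n := by
  induction j generalizing n with
  | zero => simpa [powDerivCofactor] using continuous_const
  | succ j ih =>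
    simp only [powDerivCofactor, coeff_add, mul_assoc, coeff_C_mul]
    refine .add (.mul (by fun_prop) ?_) (.mul (by fun_prop) ?_)
    · exact continuous_coeff_mul (fun _ => continuous_const) ih n
    · refine continuous_coeff_mul (fun _ => continuous_const) (fun i => ?_) n
      simp only [coeff_derivative]
      exact (ih _).mul continuous_const

theorem continuous_eval_of_continuous_coeff {Y : Type*} [TopologicalSpace Y] {f : Y → ℂ[X]}
    {N : ℕ} (hdeg : ∀ y, (f y).natDegree ≤ N) (hf : ∀ n, Continuous fun y => (f y).coeff n)
    (z : ℂ) : Continuous fun y => (f y).eval z := by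
  have : (fun y => (f y).eval z) =
      fun y => ∑ i ∈ Finset.range (N + 1), (f y).coeff i * z ^ i := by
    funext y
    exact eval_eq_sum_range' (Nat.lt_succ_of_le (hdeg y)) z
  rw [this]
  exact continuous_finsetSum _ fun i _ => (hf i).mul continuous_const

/-- The zeros of an iterated derivative stay in any convex set containing the zeros of the
polynomial, as long as the derivative does not vanish identically. -/
theorem mem_of_eval_iterate_derivative_eq_zero {K : Set ℂ} (hK : Convex ℝ K) {p : ℂ[X]}
    (hp : ∀ z, p.eval z = 0 → z ∈ K) (j : ℕ) (hj : derivative^[j] p ≠ 0) :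
    ∀ z, (derivative^[j] p).eval z = 0 → z ∈ K := by
  induction j with
  | zero => exact hp
  | succ j ih =>
    intro z hz
    rw [Function.iterate_succ_apply'] at hj hz
    set q := derivative^[j] p
    have hq0 : q ≠ 0 := by
      rintro h0
      simp [h0] at hj
    have hqdeg : 0 < q.degree := by
      by_contra! hle
      rw [eq_C_of_degree_le_zero hle] at hj
      simp at hj
    have hmem := rootSet_derivative_subset_convexHull_rootSet hqdeg
      (show z ∈ q.derivative.rootSet ℂ by simpa [mem_rootSet, hj] using hz)
    refine convexHull_min (fun w hw => ?_) hK hmem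
    exact ih hq0 w (by simpa [mem_rootSet, hq0] using hw)

/-- If the zeros of `q` and the points `x i` lie in a closed convex set `K` and the `κ i` are
nonnegative, then the zeros of
`∏ (X - x i) * derivative q + (∑ κ i ∏_{j ≠ i} (X - x j)) * q` lie in `K`. -/
theorem mem_of_eval_lame_eq_zero {ι : Type*} [Fintype ι] [DecidableEq ι] {K : Set ℂ}
    (hK : Convex ℝ K) (hKc : IsClosed K) {x : ι → ℂ} (hx : ∀ i, x i ∈ K) {κ : ι → ℝ}
    (hκ : ∀ i, 0 ≤ κ i) {q : ℂ[X]} (hq : ∀ z, q.eval z = 0 → z ∈ K)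
    (hpos : 0 < q.natDegree ∨ ∃ i, 0 < κ i) {z : ℂ}
    (hz : ((∏ i, (X - C (x i))) * derivative q + (∑ i, C (κ i : ℂ) *
      ∏ j ∈ Finset.univ.erase i, (X - C (x j))) * q).eval z = 0) : z ∈ K := by
  by_contra hzK
  obtain ⟨l, hl⟩ := Complex.exists_forall_re_div_sub_pos hK hKc hzK
  have hqz : q.eval z ≠ 0 := fun h => hzK (hq z h)
  have hne : ∀ i, z - x i ≠ 0 := fun i h => hzK (sub_eq_zero.1 h ▸ hx i)
  have hP : ∏ i, (z - x i) ≠ 0 := Finset.prod_ne_zero_iff.2 fun i _ => hne i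
  have hsum : ∑ i, (κ i : ℂ) * ∏ j ∈ Finset.univ.erase i, (z - x j) =
      (∏ i, (z - x i)) * ∑ i, (κ i : ℂ) / (z - x i) := by
    rw [Finset.mul_sum]
    refine Finset.sum_congr rfl fun i _ => ?_
    rw [← Finset.mul_prod_erase _ _ (Finset.mem_univ i)]
    field_simp [hne i]
  have hlog := (IsAlgClosed.splits q).eval_derivative_div_eval_of_ne_zero hqz
  simp only [eval_add, eval_mul, eval_prod, eval_sub, eval_X, eval_C, eval_finsetSum] at hz
  rw [hsum] at hz
  have hzero : (q.roots.map fun w => 1 / (z - w)).sum + ∑ i, (κ i : ℂ) / (z - x i) = 0 := by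
    rw [← hlog]
    apply mul_left_cancel₀ (mul_ne_zero hP hqz)
    rw [mul_zero, ← hz]
    field_simp
  have hre := congrArg (fun w => (l * w).re) hzero
  simp only [mul_add, mul_zero, Complex.add_re, Complex.zero_re, Finset.mul_sum,
    Complex.re_sum] at hre
  have hroots : (l * (q.roots.map fun w => 1 / (z - w)).sum).re =
      (q.roots.map fun w => (l / (z - w)).re).sum := by
    rw [← Multiset.sum_map_mul_left]
    simpa [Multiset.map_map, Function.comp_def, div_eq_mul_inv] using
      map_multiset_sum Complex.reAddGroupHom (q.roots.map fun w => l * (1 / (z - w)))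
  have hterm : ∀ i, (l * ((κ i : ℂ) / (z - x i))).re = κ i * (l / (z - x i)).re := by
    intro i
    rw [← Complex.re_ofReal_mul]
    ring_nf
  rw [hroots] at hre
  simp only [hterm] at hre
  have hroot_pos : ∀ w ∈ q.roots, 0 < (l / (z - w)).re :=
    fun w hw => hl w (hq w (isRoot_of_mem_roots hw))
  have hnn1 : 0 ≤ (q.roots.map fun w => (l / (z - w)).re).sum := by
    apply Multiset.sum_nonneg
    simp only [Multiset.mem_map]
    rintro _ ⟨w, hw, rfl⟩
    exact (hroot_pos w hw).le
  have hnn2 : ∀ i ∈ Finset.univ, 0 ≤ κ i * (l / (z - x i)).re :=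
    fun i _ => mul_nonneg (hκ i) (hl _ (hx i)).le
  rcases hpos with hdeg | ⟨i, hi⟩
  · have hne0 : q.roots ≠ 0 := by
      rw [← Multiset.card_pos, ← (IsAlgClosed.splits q).natDegree_eq_card_roots]
      exact hdeg
    obtain ⟨w, hw⟩ := Multiset.exists_mem_of_ne_zero hne0
    obtain ⟨s, hs⟩ := Multiset.exists_cons_of_mem hw
    rw [hs, Multiset.map_cons, Multiset.sum_cons] at hre
    have h1 := hroot_pos w hw
    have h2 : 0 ≤ (s.map fun w => (l / (z - w)).re).sum := by
      apply Multiset.sum_nonneg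
      simp only [Multiset.mem_map]
      rintro _ ⟨v, hv, rfl⟩
      exact (hroot_pos v (hs ▸ Multiset.mem_cons_of_mem hv)).le
    linarith [Finset.sum_nonneg hnn2]
  · have := Finset.single_le_sum hnn2 (Finset.mem_univ i)
    have := mul_pos hi (hl _ (hx i))
    linarith

/-- If a closed set `S` containing `a` and `b` is invariant under
`p ↦ A * p^(k+1) + B * p^(k)` for polynomials of large degree, where `deg B < deg A`, then `S`
contains all zeros of `A` and the midpoint of `a` and `b`. -/
theorem mem_of_eval_mul_derivative_pow_eq_zero {A B : ℂ[X]} (hA : A ≠ 0)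
    (hB : B.natDegree + 1 ≤ A.natDegree) {k n : ℕ} {S : Set ℂ} (hS : IsClosed S)
    (hinv : TGeInvariant (fun p => A * derivative^[k + 1] p + B * derivative^[k] p) n S)
    {a b : ℂ} (ha : a ∈ S) (hb : b ∈ S) {z : ℂ}
    (hz : (A * derivative ((X - C a) * (X - C b)) ^ (k + 1)).eval z = 0) : z ∈ S := by
  set W : ℂ[X] := (X - C a) * (X - C b) with hWdef
  have hWmonic : W.Monic := (monic_X_sub_C a).mul (monic_X_sub_C b)
  have hWdeg : W.natDegree = 2 := by
    rw [hWdef, (monic_X_sub_C a).natDegree_mul (monic_X_sub_C b)]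
    simp
  have hW' : derivative W = C 2 * X - C (a + b) := by
    simp only [hWdef, derivative_mul, derivative_X_sub_C, C_add, C_ofNat]
    ring
  set N := A.natDegree + (k + 1) with hN
  set G : ℂ → ℂ[X] := fun ε =>
    A * powDerivCofactor W ε (k + 1) + B * (C ε * (W * powDerivCofactor W ε k)) with hG
  have hGdeg : ∀ ε, (G ε).natDegree ≤ N := by
    intro ε
    apply natDegree_add_le_of_degree_le
    · exact natDegree_mul_le_of_le le_rfl (natDegree_powDerivCofactor_le hWdeg.le ε _)
    · refine (natDegree_mul_le_of_le le_rfl ((natDegree_C_mul_le _ _).trans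
        (natDegree_mul_le_of_le hWdeg.le (natDegree_powDerivCofactor_le hWdeg.le ε _)))).trans ?_
      omega
  have hGcont : ∀ i, Continuous fun ε => (G ε).coeff i := by
    intro i
    simp only [hG, coeff_add]
    refine .add ?_ ?_
    · exact continuous_coeff_mul (fun _ => continuous_const)
        (continuous_coeff_powDerivCofactor W _) i
    · refine continuous_coeff_mul (fun _ => continuous_const) (fun i' => ?_) i
      simp only [coeff_C_mul]
      exact continuous_id.mul (continuous_coeff_mul (fun _ => continuous_const)
        (continuous_coeff_powDerivCofactor W _) i')
  have hG0 : G 0 = A * derivative W ^ (k + 1) := by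
    simp [hG, powDerivCofactor_zero]
  have hWd' : (derivative W).natDegree = 1 := by
    rw [hW', natDegree_sub_C, natDegree_C_mul_X _ two_ne_zero]
  have hW'0 : derivative W ≠ 0 := by
    intro h0
    simp [h0] at hWd'
  have hlead : (G 0).coeff N ≠ 0 := by
    have hdeg : (G 0).natDegree = N := by
      rw [hG0, natDegree_mul hA (pow_ne_zero _ hW'0), natDegree_pow, hWd', mul_one]
    rw [← hdeg]
    exact leadingCoeff_ne_zero.2 (hG0 ▸ mul_ne_zero hA (pow_ne_zero _ hW'0))
  have hinvm : Tendsto (fun m : ℕ => ((m : ℂ))⁻¹) atTop (𝓝 0) :=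
    tendsto_inv_atTop_nhds_zero_nat (𝕜 := ℂ)
  refine hS.mem_of_tendsto_eval_zero (G := fun m : ℕ => G (m : ℂ)⁻¹) (fun m => hGdeg _)
    (((hGcont N).tendsto 0).comp hinvm) hlead ?_ ?_
  · have := ((continuous_eval_of_continuous_coeff hGdeg hGcont z).tendsto 0).comp hinvm
    rw [hG0, hz] at this
    exact this
  · filter_upwards [eventually_ge_atTop n, eventually_ge_atTop (k + 1)] with m hmn hmk hGm w hw
    have hm0 : m ≠ 0 := by omega
    have hmC : (m : ℂ) ≠ 0 := by exact_mod_cast hm0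
    have hfactor : A * derivative^[k + 1] (W ^ m) + B * derivative^[k] (W ^ m) =
        C ((m : ℂ) ^ (k + 1)) * W ^ (m - (k + 1)) * G (m : ℂ)⁻¹ := by
      rw [iterate_derivative_pow_eq W hm0 hmk, iterate_derivative_pow_eq W hm0 (by omega),
        show m - k = m - (k + 1) + 1 by omega]
      have h2 : (C (m : ℂ)⁻¹ : ℂ[X]) * C (m : ℂ) = 1 := by
        rw [← C_mul, inv_mul_cancel₀ hmC, C_1]
      simp only [hG, C_pow]
      linear_combination (-(B * C (m : ℂ) ^ k * W ^ (m - (k + 1)) * W *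
        powDerivCofactor W (m : ℂ)⁻¹ k)) * h2
    have hT := hinv (W ^ m) (pow_ne_zero _ hWmonic.ne_zero)
      (by rw [natDegree_pow, hWdeg]; omega) ?_
    · simp only [hfactor] at hT
      rcases hT with hT | hT
      · exact absurd hT (mul_ne_zero (mul_ne_zero (C_ne_zero.2 (pow_ne_zero _ hmC))
          (pow_ne_zero _ hWmonic.ne_zero)) hGm)
      · exact hT w (by rw [eval_mul, hw, mul_zero])
    · intro v hv
      rw [eval_pow] at hv
      have := eq_zero_of_pow_eq_zero hv
      simp only [hWdef, eval_mul, eval_sub, eval_X, eval_C, mul_eq_zero, sub_eq_zero] at this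
      rcases this with rfl | rfl
      exacts [ha, hb]

end Polynomial

theorem lame_type_operator_convex_hull_invariant (k d : ℕ) (hk : 1 ≤ k) (hd : 1 ≤ d)
    (c : ℂ) (hc : c ≠ 0) (x : Fin d → ℂ) (κ : Fin d → ℝ) (hκ : ∀ i, 0 ≤ κ i)
    (Qk Qkm1 : Polynomial ℂ)
    (hQk : Qk = Polynomial.C c * ∏ i : Fin d, (Polynomial.X - Polynomial.C (x i)))
    (hQkm1 : Qkm1 = Polynomial.C c * ∑ i : Fin d, Polynomial.C (κ i : ℂ) *
      ∏ j ∈ Finset.univ.erase i, (Polynomial.X - Polynomial.C (x j)))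
    (T : Polynomial ℂ → Polynomial ℂ)
    (hT : T = fun p => Qk * (⇑(Polynomial.derivative (R := ℂ)))^[k] p
      + Qkm1 * (⇑(Polynomial.derivative (R := ℂ)))^[k - 1] p)
    (K : Set ℂ) (hK : K = convexHull ℝ (Set.range x)) :
    TGeInvariant T 0 K ∧
      ∀ n : ℕ, K = ⋂₀ {S : Set ℂ | S.Nonempty ∧ IsClosed S ∧ TGeInvariant T n S} := by
  obtain ⟨k, rfl⟩ : ∃ k', k = k' + 1 := ⟨k - 1, by omega⟩
  rw [Nat.add_sub_cancel] at hT
  set P : ℂ[X] := ∏ i : Fin d, (X - C (x i)) with hP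
  set R : ℂ[X] := ∑ i : Fin d, C (κ i : ℂ) * ∏ j ∈ Finset.univ.erase i, (X - C (x j)) with hR
  have hKconv : Convex ℝ K := hK ▸ convex_convexHull ℝ _
  have hKclosed : IsClosed K := hK ▸ (Set.finite_range x).isClosed_convexHull ℝ
  have hxK : ∀ i, x i ∈ K := fun i => hK ▸ subset_convexHull ℝ _ ⟨i, rfl⟩
  have hinv : TGeInvariant T 0 K := by
    intro p _ _ hpK
    by_cases hq0 : derivative^[k] p = 0
    · left
      simp [hT, Function.iterate_succ_apply', hq0]
    have hqK := mem_of_eval_iterate_derivative_eq_zero hKconv hpK k hq0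
    by_cases hpos : 0 < (derivative^[k] p).natDegree ∨ ∃ i, 0 < κ i
    · right
      intro z hz
      refine mem_of_eval_lame_eq_zero hKconv hKclosed hxK hκ hqK hpos ?_
      have hTp : T p = C c * (P * derivative (derivative^[k] p) + R * derivative^[k] p) := by
        simp only [hT, hQk, hQkm1, Function.iterate_succ_apply']
        ring
      rw [hTp, eval_mul, eval_C] at hz
      exact (mul_eq_zero.1 hz).resolve_left hc
    · left
      push Not at hpos
      have hκ0 : ∀ i, κ i = 0 := fun i => le_antisymm (hpos.2 i) (hκ i)
      have hq' : derivative (derivative^[k] p) = 0 :=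
        derivative_of_natDegree_zero (Nat.le_zero.1 hpos.1)
      simp [hT, hQkm1, hR, hκ0, Function.iterate_succ_apply', hq']
  refine ⟨hinv, fun n => Set.Subset.antisymm ?_ ?_⟩
  · rintro z hz S ⟨⟨s, hs⟩, hSc, hSinv⟩
    rw [hT] at hSinv
    have hPmonic : P.Monic := monic_prod_of_monic _ _ fun i _ => monic_X_sub_C _
    have hQk0 : Qk ≠ 0 := hQk ▸ mul_ne_zero (C_ne_zero.2 hc) hPmonic.ne_zero
    have hQkdeg : Qk.natDegree = d := by
      rw [hQk, natDegree_C_mul hc, hP, natDegree_finsetProd_X_sub_C_eq_card]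
      simp
    have hQkm1deg : Qkm1.natDegree + 1 ≤ Qk.natDegree := by
      have : Qkm1.natDegree ≤ d - 1 := by
        rw [hQkm1]
        refine (natDegree_C_mul_le _ _).trans (natDegree_sum_le_of_forall_le _ _ fun i _ => ?_)
        refine (natDegree_C_mul_le _ _).trans ?_
        rw [natDegree_finsetProd_X_sub_C_eq_card]
        simp
      omega
    have hmem : ∀ a ∈ S, ∀ b ∈ S, ∀ w,
        (Qk * derivative ((X - C a) * (X - C b)) ^ (k + 1)).eval w = 0 → w ∈ S :=
      fun a ha b hb w hw =>
        mem_of_eval_mul_derivative_pow_eq_zero hQk0 hQkm1deg hSc hSinv ha hb hw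
    have hxS : Set.range x ⊆ S := by
      rintro _ ⟨i, rfl⟩
      refine hmem s hs s hs _ ?_
      have : P.eval (x i) = 0 := by
        rw [hP, eval_prod]
        exact Finset.prod_eq_zero (Finset.mem_univ i) (by simp)
      simp [hQk, this]
    have hSconv : Convex ℝ S := hSc.convex_of_forall_midpoint_mem fun a ha b hb => by
      refine hmem a ha b hb _ ?_
      have hder : (derivative ((X - C a) * (X - C b))).eval (midpoint ℝ a b) = 0 := by
        simp only [midpoint_eq_smul_add, derivative_mul, derivative_sub, derivative_X,
          derivative_C, eval_add, eval_mul, eval_sub, eval_X, eval_C, eval_one, eval_zero,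
          Complex.real_smul, invOf_eq_inv]
        push_cast
        ring
      rw [eval_mul, eval_pow, hder, zero_pow k.succ_ne_zero, mul_zero]
    exact convexHull_min hxS hSconv (hK ▸ hz)
  · exact Set.sInter_subset_of_mem
      ⟨⟨x ⟨0, hd⟩, hxK _⟩, hKclosed, fun p hp _ hpK => hinv p hp (Nat.zero_le _) hpK⟩
end

section
/- Let k ≥ 1 and let Q_0, …, Q_k ∈ ℂ[x] with Q_k ≠ 0, let T(p) = ∑_{j=0}^k Q_j · p^{(j)}, and assume T is degenerate, i.e. deg Q_j − j > deg Q_k − k for some 0 ≤ j < k with Q_j ≠ 0. Then for every integer n ≥ 0, every nonempty closed T_{≥n}-invariant set S ⊆ ℂ is unbounded. -/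
open Polynomial

/-- `T` is degenerate: `deg Q_j − j > deg Q_k − k` for some `0 ≤ j < k` with `Q_j ≠ 0`. -/
def Degenerate (k : ℕ) (Q : ℕ → Polynomial ℂ) : Prop :=
  ∃ j < k, Q j ≠ 0 ∧ ((Q k).natDegree : ℤ) - k < ((Q j).natDegree : ℤ) - j

open Filter Topology

/-- A linear combination of falling factorials is asymptotic to its top term. -/
lemma tendsto_sum_descFactorial_div (k : ℕ) (c : ℕ → ℂ) :
    Tendsto (fun m : ℕ => (∑ j ∈ Finset.range (k + 1), (m.descFactorial j : ℂ) * c j) /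
      (m.descFactorial k : ℂ)) atTop (𝓝 (c k)) := by
  induction k with
  | zero => simp
  | succ k ih =>
    have hinv : Tendsto (fun m : ℕ => ((m - k : ℕ) : ℂ)⁻¹) atTop (𝓝 0) :=
      (tendsto_inv_atTop_nhds_zero_nat (𝕜 := ℂ)).comp (tendsto_sub_atTop_nat k)
    have hlim := (hinv.mul ih).add_const (c (k + 1))
    rw [zero_mul, zero_add] at hlim
    refine hlim.congr' ?_
    filter_upwards [eventually_ge_atTop (k + 1)] with m hm
    have hsub : ((m - k : ℕ) : ℂ) ≠ 0 := by
      rw [Nat.cast_ne_zero]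
      omega
    have hfac : (m.descFactorial k : ℂ) ≠ 0 := by
      rw [Nat.cast_ne_zero, Ne, Nat.descFactorial_eq_zero_iff_lt]
      omega
    rw [Finset.sum_range_succ _ (k + 1), Nat.descFactorial_succ]
    push_cast
    field_simp

lemma norm_eval_le_of_forall_root_norm_le {p : ℂ[X]} {B : ℝ}
    (hp : ∀ z ∈ p.roots, ‖z‖ ≤ B) (w : ℂ) :
    ‖p.eval w‖ ≤ ‖p.leadingCoeff‖ * (‖w‖ + B) ^ p.natDegree := by
  have hsplit : p.Splits := IsAlgClosed.splits p
  rw [hsplit.eval_eq_prod_roots, norm_mul]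
  gcongr
  have hnorm : ‖(p.roots.map (w - ·)).prod‖ = (p.roots.map fun z => ‖w - z‖).prod := by
    simpa [Multiset.map_map] using map_multiset_prod (normHom : ℂ →*₀ ℝ) (p.roots.map (w - ·))
  rw [hsplit.natDegree_eq_card_roots, hnorm]
  refine (Multiset.prod_map_le_prod_map₀ _ (fun _ => ‖w‖ + B)
    (fun _ _ => norm_nonneg _) ?_).trans ?_
  · exact fun z hz => (norm_sub_le w z).trans (by linarith [hp z hz])
  · simp

/-- If some `F j` with `j < k` has larger degree than `F k`, then for large `m` the combination of
the `F j` with falling-factorial coefficients is nonzero and has a root outside any given disc. -/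
lemma eventually_exists_root_norm_gt {k : ℕ} {F : ℕ → ℂ[X]} (hFk : F k ≠ 0)
    (hF : ∃ j < k, (F k).natDegree < (F j).natDegree) (B : ℝ) :
    ∀ᶠ m : ℕ in atTop,
      (∑ j ∈ Finset.range (k + 1), C (m.descFactorial j : ℂ) * F j) ≠ 0 ∧
      ∃ z, (∑ j ∈ Finset.range (k + 1), C (m.descFactorial j : ℂ) * F j).eval z = 0 ∧ B < ‖z‖ := by
  set R : ℕ → ℂ[X] := fun m => ∑ j ∈ Finset.range (k + 1), C (m.descFactorial j : ℂ) * F j with hR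
  obtain ⟨j₁, hj₁, hmax⟩ := Finset.exists_max_image (Finset.range (k + 1))
    (fun j => (F j).natDegree) ⟨0, by simp⟩
  set d := (F j₁).natDegree with hd
  obtain ⟨i, hik, hi⟩ := hF
  have hkd : (F k).natDegree < d := hi.trans_le (hmax i (by simp; omega))
  have hcoeff_k : (F k).coeff d = 0 := coeff_eq_zero_of_natDegree_lt hkd
  have hcoeff_j₁ : (F j₁).coeff d ≠ 0 := by
    rw [hd, coeff_natDegree, leadingCoeff_ne_zero]
    rintro h
    simp [hd, h] at hkd
  have hcoeff (m : ℕ) : (R m).coeff d =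
      ∑ j ∈ Finset.range (k + 1), (m.descFactorial j : ℂ) * (F j).coeff d := by
    simp only [hR, finsetSum_coeff, coeff_C_mul]
  have hdeg (m : ℕ) : (R m).natDegree ≤ d :=
    natDegree_sum_le_of_forall_le _ _ fun j hj => (natDegree_C_mul_le _ _).trans (hmax j hj)
  have hcoeff_ne : ∀ᶠ m : ℕ in atTop, (R m).coeff d ≠ 0 := by
    obtain ⟨j₀, hj₀, hlast⟩ := Finset.exists_max_image
      ((Finset.range (k + 1)).filter fun j => (F j).coeff d ≠ 0) id
      ⟨j₁, by simpa using ⟨by simpa using hj₁, hcoeff_j₁⟩⟩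
    rw [Finset.mem_filter, Finset.mem_range] at hj₀
    have hlim := tendsto_sum_descFactorial_div j₀ fun j => (F j).coeff d
    filter_upwards [hlim.eventually_ne hj₀.2] with m hm hzero
    apply hm
    rw [hcoeff, ← Finset.sum_subset (Finset.range_mono (show j₀ + 1 ≤ k + 1 by omega))] at hzero
    · rw [hzero, zero_div]
    · intro j hj hj'
      rw [mul_eq_zero]
      right
      by_contra hne
      have := hlast j (Finset.mem_filter.2 ⟨hj, hne⟩)
      simp only [id, Finset.mem_range] at this hj'
      omega
  obtain ⟨w, hw⟩ : ∃ w, (F k).eval w ≠ 0 := by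
    by_contra! h
    exact hFk (Polynomial.funext (by simpa using h))
  have heval : Tendsto (fun m : ℕ => (R m).eval w / (m.descFactorial k : ℂ)) atTop
      (𝓝 ((F k).eval w)) := by
    simpa [hR, eval_finsetSum] using tendsto_sum_descFactorial_div k fun j => (F j).eval w
  have hlead : Tendsto (fun m : ℕ => (R m).coeff d / (m.descFactorial k : ℂ)) atTop (𝓝 0) := by
    simpa [hcoeff, hcoeff_k] using tendsto_sum_descFactorial_div k fun j => (F j).coeff d
  have hlt : ∀ᶠ m : ℕ in atTop, ‖(R m).coeff d / (m.descFactorial k : ℂ)‖ * (‖w‖ + B) ^ d <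
      ‖(R m).eval w / (m.descFactorial k : ℂ)‖ := by
    refine (hlead.norm.mul_const _).eventually_lt heval.norm ?_
    simpa using hw
  filter_upwards [hlt, hcoeff_ne] with m hm hne
  have hRm : R m ≠ 0 := fun h => hne (by simp [h])
  refine ⟨hRm, ?_⟩
  by_contra! hroots
  have hnat : (R m).natDegree = d := natDegree_eq_of_le_of_coeff_ne_zero (hdeg m) hne
  have hle := norm_eval_le_of_forall_root_norm_le
    (fun z hz => hroots z (isRoot_of_mem_roots hz)) w
  rw [leadingCoeff, hnat] at hle
  refine hm.not_ge ?_
  rw [norm_div, norm_div, div_mul_eq_mul_div]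
  gcongr

lemma diffOp_X_sub_C_pow (k : ℕ) (Q : ℕ → ℂ[X]) (a : ℂ) {m : ℕ} (hm : k ≤ m) :
    diffOp k Q ((X - C a) ^ m) = (X - C a) ^ (m - k) *
      ∑ j ∈ Finset.range (k + 1), C (m.descFactorial j : ℂ) * (Q j * (X - C a) ^ (k - j)) := by
  rw [diffOp, Finset.mul_sum]
  refine Finset.sum_congr rfl fun j hj => ?_
  have hj : j ≤ k := by simpa [Nat.lt_succ_iff] using hj
  rw [iterate_derivative_X_sub_pow, show m - j = (m - k) + (k - j) by omega, pow_add, nsmul_eq_mul]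
  simp only [map_natCast]
  ring

theorem degenerate_invariant_sets_unbounded (k : ℕ) (hk : 1 ≤ k) (Q : ℕ → Polynomial ℂ)
    (hQk : Q k ≠ 0) (hdeg : Degenerate k Q) (n : ℕ) (S : Set ℂ)
    (hSne : S.Nonempty) (hSclosed : IsClosed S)
    (hSinv : TGeInvariant (diffOp k Q) n S) :
    ¬ Bornology.IsBounded S := by
  intro hbdd
  obtain ⟨B, hB⟩ := hbdd.exists_norm_le
  obtain ⟨a, ha⟩ := hSne
  have hF : ∃ j < k, (Q k * (X - C a) ^ (k - k)).natDegree <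
      (Q j * (X - C a) ^ (k - j)).natDegree := by
    obtain ⟨j, hjk, hQj, hlt⟩ := hdeg
    refine ⟨j, hjk, ?_⟩
    rw [natDegree_mul hQj (pow_ne_zero _ (X_sub_C_ne_zero a)), natDegree_pow, natDegree_X_sub_C,
      Nat.sub_self, pow_zero, mul_one]
    omega
  have hFk : Q k * (X - C a) ^ (k - k) ≠ 0 := mul_ne_zero hQk (pow_ne_zero _ (X_sub_C_ne_zero a))
  obtain ⟨m, ⟨hne, z, hz, hzB⟩, hmk, hmn⟩ :=
    ((eventually_exists_root_norm_gt (F := fun j => Q j * (X - C a) ^ (k - j)) hFk hF B).and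
      ((eventually_ge_atTop k).and (eventually_ge_atTop n))).exists
  have hpow (i : ℕ) : (X - C a) ^ i ≠ 0 := pow_ne_zero i (X_sub_C_ne_zero a)
  have hroots (x : ℂ) (hx : ((X - C a) ^ m).eval x = 0) : x ∈ S := by
    rw [eval_pow, eval_sub, eval_X, eval_C] at hx
    rwa [sub_eq_zero.1 (eq_zero_of_pow_eq_zero hx)]
  rcases hSinv ((X - C a) ^ m) (hpow m) (by simpa using hmn) hroots with h | h
  · rw [diffOp_X_sub_C_pow k Q a hmk] at h
    exact mul_ne_zero (hpow _) hne h
  · refine hzB.not_ge (hB z (h z ?_))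
    rw [diffOp_X_sub_C_pow k Q a hmk, eval_mul, hz, mul_zero]
end
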